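/- arXiv:2401.07979 — 2 statements merged into one kernel-verified Lean document; each statement's English description precedes it below -/
import Mathlib

section
/- Let q ≥ 0, let F be (λ,Λ)-elliptic, let f ∈ L^∞(B₁) be continuous, and let u_q be a classical viscosity solution of |Du_q|^q F(D²u_q) = f in B₁ with ‖u_q‖_{L^∞(B₁)} ≤ 1. Then there exists a constant C, depending only on n, λ, Λ and ‖f‖_{L^∞(B₁)}, but independent of q, such that |u_q(x) − u_q(y)| ≤ C|x−y| for all x, y ∈ B_{1/2}. -/
open Metric Set Matrix MeasureTheory
open scoped RealInnerProductSpace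

noncomputable section

abbrev Euc (n : ℕ) := EuclideanSpace ℝ (Fin n)

def EllMat (n : ℕ) (lam Lam : ℝ) : Set (Matrix (Fin n) (Fin n) ℝ) :=
  {A | A.IsSymm ∧ ∀ ξ : Fin n → ℝ,
      lam * (ξ ⬝ᵥ ξ) ≤ ξ ⬝ᵥ A.mulVec ξ ∧ ξ ⬝ᵥ A.mulVec ξ ≤ Lam * (ξ ⬝ᵥ ξ)}

/-- Pucci maximal operator `M⁺`. -/
def pucciSup (n : ℕ) (lam Lam : ℝ) (M : Matrix (Fin n) (Fin n) ℝ) : ℝ :=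
  sSup ((fun A => (A * M).trace) '' EllMat n lam Lam)

/-- Pucci minimal operator `M⁻`. -/
def pucciInf (n : ℕ) (lam Lam : ℝ) (M : Matrix (Fin n) (Fin n) ℝ) : ℝ :=
  sInf ((fun A => (A * M).trace) '' EllMat n lam Lam)

/-- `(λ,Λ)`-ellipticity of `F`. -/
def IsUniformlyElliptic (n : ℕ) (lam Lam : ℝ)
    (F : Matrix (Fin n) (Fin n) ℝ → ℝ) : Prop :=
  ∀ M N : Matrix (Fin n) (Fin n) ℝ, M.IsSymm → N.IsSymm →
    pucciInf n lam Lam (M - N) ≤ F M - F N ∧ F M - F N ≤ pucciSup n lam Lam (M - N)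

/-- Hessian matrix of `φ` at `x`. -/
def hess {n : ℕ} (φ : Euc n → ℝ) (x : Euc n) : Matrix (Fin n) (Fin n) ℝ :=
  fun i j => iteratedFDeriv ℝ 2 φ x ![EuclideanSpace.single i 1, EuclideanSpace.single j 1]

/-- `κ`-grad viscosity subsolution of `G(Du, D²u) = f` in `s`. -/
def GradSubSol {n : ℕ} (κ : ℝ) (G : Euc n → Matrix (Fin n) (Fin n) ℝ → ℝ)
    (f : Euc n → ℝ) (s : Set (Euc n)) (u : Euc n → ℝ) : Prop :=
  ∀ x₀ ∈ s, ∀ φ : Euc n → ℝ, ContDiff ℝ 2 φ →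
    IsLocalMax (fun x => u x - φ x) x₀ → κ < ‖gradient φ x₀‖ →
    f x₀ ≤ G (gradient φ x₀) (hess φ x₀)

/-- `κ`-grad viscosity supersolution of `G(Du, D²u) = f` in `s`. -/
def GradSupSol {n : ℕ} (κ : ℝ) (G : Euc n → Matrix (Fin n) (Fin n) ℝ → ℝ)
    (f : Euc n → ℝ) (s : Set (Euc n)) (u : Euc n → ℝ) : Prop :=
  ∀ x₀ ∈ s, ∀ φ : Euc n → ℝ, ContDiff ℝ 2 φ →
    IsLocalMin (fun x => u x - φ x) x₀ → κ < ‖gradient φ x₀‖ →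
    G (gradient φ x₀) (hess φ x₀) ≤ f x₀

/-- `κ`-grad viscosity solution. -/
def GradSol {n : ℕ} (κ : ℝ) (G : Euc n → Matrix (Fin n) (Fin n) ℝ → ℝ)
    (f : Euc n → ℝ) (s : Set (Euc n)) (u : Euc n → ℝ) : Prop :=
  GradSubSol κ G f s u ∧ GradSupSol κ G f s u

/-- Classical viscosity solution (no restriction on the slope of test functions). -/
def ViscSol {n : ℕ} (G : Euc n → Matrix (Fin n) (Fin n) ℝ → ℝ)
    (f : Euc n → ℝ) (s : Set (Euc n)) (u : Euc n → ℝ) : Prop :=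
  (∀ x₀ ∈ s, ∀ φ : Euc n → ℝ, ContDiff ℝ 2 φ →
    IsLocalMax (fun x => u x - φ x) x₀ → f x₀ ≤ G (gradient φ x₀) (hess φ x₀)) ∧
  (∀ x₀ ∈ s, ∀ φ : Euc n → ℝ, ContDiff ℝ 2 φ →
    IsLocalMin (fun x => u x - φ x) x₀ → G (gradient φ x₀) (hess φ x₀) ≤ f x₀)

/-- The operator `G(ξ, M) = (|ξ|-κ)₊^q F(M)`. -/
def mainG {n : ℕ} (κ q : ℝ) (F : Matrix (Fin n) (Fin n) ℝ → ℝ) :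
    Euc n → Matrix (Fin n) (Fin n) ℝ → ℝ :=
  fun ξ M => max (‖ξ‖ - κ) 0 ^ q * F M

/-- The set `Ω_u` of points of `s` that can be touched from above or below by a `C²`
function with slope larger than `κ`. -/
def omegaSet {n : ℕ} (κ : ℝ) (s : Set (Euc n)) (u : Euc n → ℝ) : Set (Euc n) :=
  {x ∈ s | ∃ φ : Euc n → ℝ, ContDiff ℝ 2 φ ∧
    (IsLocalMax (fun y => u y - φ y) x ∨ IsLocalMin (fun y => u y - φ y) x) ∧
    κ < ‖gradient φ x‖}

/-- Effective viscosity solution of `(|Du|-κ)₊^q F(D²u) = f` in `s`. -/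
def EffectiveSol {n : ℕ} (κ q : ℝ) (F : Matrix (Fin n) (Fin n) ℝ → ℝ)
    (f : Euc n → ℝ) (s : Set (Euc n)) (u : Euc n → ℝ) : Prop :=
  IsOpen (omegaSet κ s u) ∧ ViscSol (mainG κ q F) f (omegaSet κ s u) u

section Convex

open Filter Topology Asymptotics

theorem abs_sub_le_of_abs_sub_le_add_sq {ψ : ℝ → ℝ} {a b : ℝ}
    (h : ∀ s ∈ Icc (0 : ℝ) 1, ∀ t ∈ Icc (0 : ℝ) 1,
      |ψ t - ψ s| ≤ a * |t - s| + b * (t - s) ^ 2) :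
    |ψ 1 - ψ 0| ≤ a := by
  have key : ∀ N : ℕ, |ψ 1 - ψ 0| ≤ a + b * (1 / ((N : ℝ) + 1)) := by
    intro N
    have hN : (0 : ℝ) < (N : ℝ) + 1 := by positivity
    set δ : ℝ := 1 / ((N : ℝ) + 1) with hδ
    have hδ0 : 0 < δ := by positivity
    have hNδ : ((N : ℝ) + 1) * δ = 1 := by rw [hδ]; field_simp
    have step : ∀ k : ℕ, k ≤ N + 1 → |ψ (k * δ) - ψ 0| ≤ k * (a * δ + b * δ ^ 2) := by
      intro k
      induction k with
      | zero => intro _; simp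
      | succ k ih =>
        intro hk
        have hk' : (k : ℝ) + 1 ≤ (N : ℝ) + 1 := by exact_mod_cast hk
        have h2 := h (k * δ) ⟨by positivity, by nlinarith⟩ ((k + 1 : ℝ) * δ)
          ⟨by positivity, by nlinarith⟩
        have h3 : (k + 1 : ℝ) * δ - k * δ = δ := by ring
        rw [h3, abs_of_pos hδ0] at h2
        have h1 := ih (by omega)
        push_cast
        calc |ψ ((k + 1 : ℝ) * δ) - ψ 0|
            ≤ |ψ ((k + 1 : ℝ) * δ) - ψ (k * δ)| + |ψ (k * δ) - ψ 0| := abs_sub_le _ _ _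
          _ ≤ _ := by linarith
    have := step (N + 1) le_rfl
    push_cast at this
    rw [hNδ] at this
    calc _ ≤ _ := this
      _ = (((N : ℝ) + 1) * δ) * (a + b * δ) := by ring
      _ = _ := by rw [hNδ, one_mul]
  have ht : Tendsto (fun N : ℕ => a + b * (1 / ((N : ℝ) + 1))) atTop (𝓝 (a + b * 0)) :=
    (tendsto_one_div_add_atTop_nhds_zero_nat.const_mul b).const_add a
  simpa using ge_of_tendsto' ht key

variable {E : Type*} [NormedAddCommGroup E] [InnerProductSpace ℝ E]

/-- If a selection of subgradients of a convex function is differentiable at a point, then the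
function has a second order expansion there. -/
theorem second_order_expansion_of_subgradient {g : E → ℝ} {q : E → E}
    (hg : ∀ z y, g z + ⟪q z, y - z⟫ ≤ g y) {z : E} {B : E →L[ℝ] E}
    (hB : ∀ τ > 0, ∀ᶠ h in 𝓝 (0 : E), ‖q (z + h) - q z - B h‖ ≤ τ * ‖h‖) :
    ∀ τ > 0, ∀ᶠ h in 𝓝 (0 : E),
      |g (z + h) - g z - ⟪q z, h⟫ - 1 / 2 * ⟪B h, h⟫| ≤ τ * ‖h‖ ^ 2 := by
  intro τ hτ
  obtain ⟨r, hr, hball⟩ := Metric.eventually_nhds_iff.1 (hB τ hτ)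
  refine Metric.eventually_nhds_iff.2 ⟨r, hr, fun h hh => ?_⟩
  rw [dist_zero_right] at hh
  set ψ : ℝ → ℝ := fun t => g (z + t • h) - g z - t * ⟪q z, h⟫ - t ^ 2 / 2 * ⟪B h, h⟫ with hψ
  have lower : ∀ s ∈ Icc (0 : ℝ) 1, ∀ t ∈ Icc (0 : ℝ) 1,
      -(τ * ‖h‖ ^ 2 * |t - s| + |⟪B h, h⟫| / 2 * (t - s) ^ 2) ≤ ψ t - ψ s := by
    intro s hs t _
    have h1 := hg (z + s • h) (z + t • h)
    have h2 : z + t • h - (z + s • h) = (t - s) • h := by module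
    rw [h2, inner_smul_right] at h1
    have hsh : ‖s • h‖ ≤ ‖h‖ := by
      rw [norm_smul, Real.norm_of_nonneg hs.1]
      exact mul_le_of_le_one_left (norm_nonneg _) hs.2
    have h3 : ‖q (z + s • h) - q z - B (s • h)‖ ≤ τ * ‖h‖ :=
      (hball (by rw [dist_zero_right]; linarith)).trans (by gcongr)
    have h4 : |⟪q (z + s • h) - q z - B (s • h), h⟫| ≤ τ * ‖h‖ ^ 2 :=
      (abs_real_inner_le_norm _ _).trans
        ((mul_le_mul_of_nonneg_right h3 (norm_nonneg _)).trans_eq (by ring))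
    rw [inner_sub_left, inner_sub_left, map_smul, real_inner_smul_left] at h4
    set e := ⟪q (z + s • h), h⟫ - ⟪q z, h⟫ - s * ⟪B h, h⟫ with he
    have h5 : -(τ * ‖h‖ ^ 2 * |t - s|) ≤ (t - s) * e := by
      have : |(t - s) * e| ≤ |t - s| * (τ * ‖h‖ ^ 2) := by
        rw [abs_mul]; gcongr
      have := neg_le_of_abs_le this
      linarith
    have h6 : -(|⟪B h, h⟫| / 2 * (t - s) ^ 2) ≤ -(⟪B h, h⟫ / 2 * (t - s) ^ 2) := by
      have := le_abs_self ⟪B h, h⟫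
      gcongr
    have h7 : ψ t - ψ s = g (z + t • h) - g (z + s • h) - (t - s) * ⟪q (z + s • h), h⟫
        + (t - s) * e - ⟪B h, h⟫ / 2 * (t - s) ^ 2 := by
      simp only [hψ, he]; ring
    rw [h7]; linarith
  have habs : |ψ 1 - ψ 0| ≤ τ * ‖h‖ ^ 2 := by
    refine abs_sub_le_of_abs_sub_le_add_sq (b := |⟪B h, h⟫| / 2) fun s hs t ht => ?_
    rw [abs_le]
    refine ⟨lower s hs t ht, ?_⟩
    have := lower t ht s hs
    rw [abs_sub_comm, sub_sq_comm] at this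
    linarith
  simpa [hψ] using habs

theorem subgradient_of_touching {g : E → ℝ} {q : E → E}
    (hg : ∀ z y, g z + ⟪q z, y - z⟫ ≤ g y) {z p : E} {C : ℝ} (hC : 0 ≤ C)
    (hup : ∀ᶠ h in 𝓝 (0 : E), g (z + h) ≤ g z + ⟪p, h⟫ + C * ‖h‖ ^ 2) :
    q z = p ∧ ∀ᶠ h in 𝓝 (0 : E), ‖q (z + h) - q z‖ ≤ 4 * C * ‖h‖ := by
  obtain ⟨r, hr, hball⟩ := Metric.eventually_nhds_iff.1 hup
  have hqp : q z = p := by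
    by_contra hne
    set v := q z - p with hv
    have hv0 : 0 < ‖v‖ := norm_pos_iff.2 (sub_ne_zero.2 hne)
    obtain ⟨t, ht0, ht1, ht2⟩ : ∃ t : ℝ, 0 < t ∧ t * ‖v‖ < r ∧ C * t < 1 := by
      refine ⟨min (r / (2 * ‖v‖)) (1 / (2 * (C + 1))), by positivity, ?_, ?_⟩
      · calc _ ≤ r / (2 * ‖v‖) * ‖v‖ := by gcongr; exact min_le_left _ _
          _ = r / 2 := by field_simp
          _ < r := by linarith
      · calc _ ≤ C * (1 / (2 * (C + 1))) := by gcongr; exact min_le_right _ _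
          _ = C / (2 * (C + 1)) := by ring
          _ < 1 := by rw [div_lt_one (by positivity)]; linarith
    have h1 := hball (y := t • v) (by
      rwa [dist_zero_right, norm_smul, Real.norm_of_nonneg ht0.le])
    have h2 := hg z (z + t • v)
    rw [add_sub_cancel_left, inner_smul_right] at h2
    rw [inner_smul_right, norm_smul, Real.norm_of_nonneg ht0.le] at h1
    have h3 : ⟪q z, v⟫ - ⟪p, v⟫ = ‖v‖ ^ 2 := by
      rw [← inner_sub_left, ← hv, real_inner_self_eq_norm_sq]
    have h4 : t * ‖v‖ ^ 2 ≤ (C * t) * (t * ‖v‖ ^ 2) := by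
      have : t * (⟪q z, v⟫ - ⟪p, v⟫) ≤ C * (t * ‖v‖) ^ 2 := by linarith
      rw [h3] at this
      linarith
    have h5 : 0 < t * ‖v‖ ^ 2 := by positivity
    nlinarith
  refine ⟨hqp, Metric.eventually_nhds_iff.2 ⟨r / 2, by positivity, fun h hh => ?_⟩⟩
  rw [dist_zero_right] at hh
  set w := q (z + h) - q z with hw
  rcases eq_or_ne w 0 with hw0 | hw0
  · rw [hw0, norm_zero]; positivity
  have hwpos : 0 < ‖w‖ := norm_pos_iff.2 hw0
  rcases eq_or_ne h 0 with h0 | h0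
  · exact absurd (by rw [hw, h0, add_zero, sub_self]) hw0
  have hhpos : 0 < ‖h‖ := norm_pos_iff.2 h0
  set k := (‖h‖ / ‖w‖) • w with hk
  have hkn : ‖k‖ = ‖h‖ := by
    rw [hk, norm_smul, Real.norm_of_nonneg (by positivity)]; field_simp
  have hhk : ‖h + k‖ ≤ 2 * ‖h‖ := (norm_add_le _ _).trans (by rw [hkn]; linarith)
  have h1 := hball (y := h + k) (by rw [dist_zero_right]; linarith)
  have h2 := hg z (z + h)
  have h3 := hg (z + h) (z + (h + k))
  rw [show z + (h + k) - (z + h) = k by abel] at h3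
  rw [add_sub_cancel_left] at h2
  rw [← hqp, inner_add_right] at h1
  have h4 : ⟪q (z + h), k⟫ - ⟪q z, k⟫ = ‖h‖ * ‖w‖ := by
    rw [← inner_sub_left, ← hw, hk, inner_smul_right, real_inner_self_eq_norm_sq]
    field_simp
  have h5 : C * ‖h + k‖ ^ 2 ≤ C * (2 * ‖h‖) ^ 2 := by gcongr
  have h6 : ‖h‖ * ‖w‖ ≤ ‖h‖ * (4 * C * ‖h‖) := by nlinarith
  exact le_of_mul_le_mul_left h6 hhpos

/-- If the resolvent `J` of a selection `q` is differentiable at `z + q z` and `q` is Lipschitz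
at `z`, then `q` is differentiable at `z`. -/
theorem subgradient_differentiable_of_resolvent [FiniteDimensional ℝ E] {q J : E → E}
    {A : E →L[ℝ] E} (hJ : ∀ z, J (z + q z) = z) {z : E} {C : ℝ} (hA : HasFDerivAt J A (z + q z))
    (hq : ∀ᶠ h in 𝓝 (0 : E), ‖q (z + h) - q z‖ ≤ C * ‖h‖) :
    ∃ B : E →L[ℝ] E, ∀ τ > 0, ∀ᶠ h in 𝓝 (0 : E), ‖q (z + h) - q z - B h‖ ≤ τ * ‖h‖ := by
  set k : E → E := fun h => h + (q (z + h) - q z) with hk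
  have hkO : k =O[𝓝 0] (fun h : E => h) :=
    (isBigO_refl _ _).add (IsBigO.of_bound C hq)
  have hk0 : Tendsto k (𝓝 0) (𝓝 0) := hkO.trans_tendsto tendsto_id
  have hlo : (fun h => h - A (k h)) =o[𝓝 0] (fun h : E => h) := by
    have h1 := ((hasFDerivAt_iff_isLittleO_nhds_zero.1 hA).comp_tendsto hk0).trans_isBigO hkO
    refine h1.congr_left fun h => ?_
    have : z + q z + k h = (z + h) + q (z + h) := by simp only [hk]; abel
    simp only [Function.comp_apply, this, hJ, add_sub_cancel_left]
  have hsurj : Function.Surjective A := by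
    rw [← ContinuousLinearMap.coe_coe, ← LinearMap.range_eq_top, ← Submodule.orthogonal_eq_bot_iff,
      Submodule.eq_bot_iff]
    intro η hη
    by_contra hη0
    have hpos : 0 < ‖η‖ := norm_pos_iff.2 hη0
    obtain ⟨r, hr, hball⟩ := Metric.eventually_nhds_iff.1 (hlo.def (c := 1 / 2) (by norm_num))
    set t := r / (2 * ‖η‖) with ht
    have ht0 : 0 < t := by positivity
    have htn : ‖t • η‖ = r / 2 := by
      rw [norm_smul, Real.norm_of_nonneg ht0.le, ht]; field_simp
    have h1 := hball (y := t • η) (by rw [dist_zero_right, htn]; linarith)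
    have h2 : ⟪A (k (t • η)), η⟫ = 0 := (Submodule.mem_orthogonal _ _).1 hη _ ⟨_, rfl⟩
    have h3 : ⟪t • η - A (k (t • η)), η⟫ = t * ‖η‖ ^ 2 := by
      rw [inner_sub_left, h2, real_inner_smul_left, real_inner_self_eq_norm_sq, sub_zero]
    have h4 := real_inner_le_norm (t • η - A (k (t • η))) η
    rw [h3] at h4
    have h5 : ‖t • η - A (k (t • η))‖ * ‖η‖ ≤ 1 / 2 * (t * ‖η‖) * ‖η‖ := by
      gcongr
      rwa [norm_smul, Real.norm_of_nonneg ht0.le] at h1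
    have h6 : 0 < t * ‖η‖ ^ 2 := by positivity
    nlinarith
  have hinj : Function.Injective A := by
    have : Function.Injective (A : E →ₗ[ℝ] E) := LinearMap.injective_iff_surjective.2 hsurj
    exact this
  let e := (LinearEquiv.ofBijective (A : E →ₗ[ℝ] E) ⟨hinj, hsurj⟩).toContinuousLinearEquiv
  have he : ∀ x, e.symm (A x) = x := fun x => e.symm_apply_apply x
  refine ⟨(e.symm : E →L[ℝ] E) - ContinuousLinearMap.id ℝ E, fun τ hτ => ?_⟩
  have h1 : (fun h => (e.symm : E →L[ℝ] E) (h - A (k h))) =o[𝓝 0] (fun h : E => h) :=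
    ((e.symm : E →L[ℝ] E).isBigO_comp _ _).trans_isLittleO hlo
  filter_upwards [h1.def hτ] with h hh
  have h2 : (e.symm : E →L[ℝ] E) (h - A (k h)) = e.symm h - k h := by
    rw [map_sub]
    exact congrArg _ (he _)
  rw [h2] at hh
  rw [← norm_neg]
  have h3 : -(q (z + h) - q z - ((e.symm : E →L[ℝ] E) - ContinuousLinearMap.id ℝ E) h)
      = e.symm h - k h := by
    change -(q (z + h) - q z - (e.symm h - h)) = e.symm h - (h + (q (z + h) - q z))
    abel
  rwa [h3]

theorem exists_resolvent [FiniteDimensional ℝ E] {g : E → ℝ} {q : E → E}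
    (hg : ∀ z y, g z + ⟪q z, y - z⟫ ≤ g y) :
    ∃ (K : NNReal) (J : E → E), LipschitzWith K J ∧ ∀ z, J (z + q z) = z := by
  have hmono : ∀ z y, ‖z - y‖ ≤ ‖z + q z - (y + q y)‖ := by
    intro z y
    have h1 := hg z y
    have h2 := hg y z
    have h3 : ⟪q z, y - z⟫ = -⟪q z, z - y⟫ := by rw [← inner_neg_right, neg_sub]
    have h4 : 0 ≤ ⟪q z - q y, z - y⟫ := by rw [inner_sub_left]; linarith
    have h5 : ‖z - y‖ ^ 2 ≤ ⟪z + q z - (y + q y), z - y⟫ := by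
      rw [show z + q z - (y + q y) = (z - y) + (q z - q y) by abel, inner_add_left,
        real_inner_self_eq_norm_sq]
      linarith
    have h6 := h5.trans (real_inner_le_norm _ _)
    rcases (norm_nonneg (z - y)).eq_or_lt with h0 | h0
    · rw [← h0]; exact norm_nonneg _
    · rw [sq] at h6
      exact le_of_mul_le_mul_right h6 h0
  have hinj : Function.Injective (fun z => z + q z) := by
    intro z y h
    have := hmono z y
    simp only at h
    rw [h, sub_self, norm_zero] at this
    exact sub_eq_zero.1 (norm_le_zero_iff.1 this)
  have hinv := Function.leftInverse_invFun hinj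
  have hL : LipschitzOnWith 1 (Function.invFun (fun z => z + q z)) (range fun z => z + q z) := by
    refine LipschitzOnWith.of_dist_le_mul ?_
    rintro _ ⟨z, rfl⟩ _ ⟨y, rfl⟩
    have e1 := hinv z
    have e2 := hinv y
    simp only at e1 e2 ⊢
    rw [e1, e2, dist_eq_norm, dist_eq_norm, NNReal.coe_one, one_mul]
    exact hmono z y
  obtain ⟨J, hJ, hJeq⟩ := hL.extend_finite_dimension
  exact ⟨_, J, hJ, fun z => (hJeq ⟨z, rfl⟩).symm.trans (hinv z)⟩

/-- A combination of the lemmas of Jensen and Alexandrov: among the contact points of a convex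
function `g` with tilted copies of `θ`, at least one is a point of twice differentiability. -/
theorem exists_contact_second_order [FiniteDimensional ℝ E] {g θ : E → ℝ} {q θ' : E → E}
    {Ω : Set E} {K : NNReal} {C δ : ℝ} (hC : 0 ≤ C) (hδ : 0 < δ)
    (hg : ∀ z y, g z + ⟪q z, y - z⟫ ≤ g y)
    (hθ' : LipschitzOnWith K θ' Ω)
    (hθ : ∀ z ∈ Ω, ∀ h, θ (z + h) ≤ θ z + ⟪θ' z, h⟫ + C * ‖h‖ ^ 2)
    (hcontact : ∀ ζ ∈ ball (0 : E) δ, ∃ z ∈ Ω, ∀ᶠ h in 𝓝 (0 : E),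
      g (z + h) - θ (z + h) - ⟪ζ, h⟫ ≤ g z - θ z) :
    ∃ ζ ∈ ball (0 : E) δ, ∃ z ∈ Ω, (∀ᶠ h in 𝓝 (0 : E),
      g (z + h) - θ (z + h) - ⟪ζ, h⟫ ≤ g z - θ z) ∧ q z = θ' z + ζ ∧
      ∃ B : E →L[ℝ] E, ∀ τ > 0, ∀ᶠ h in 𝓝 (0 : E),
        |g (z + h) - g z - ⟪q z, h⟫ - 1 / 2 * ⟪B h, h⟫| ≤ τ * ‖h‖ ^ 2 := by
  let _ : MeasurableSpace E := borel E
  have : BorelSpace E := ⟨rfl⟩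
  obtain ⟨KJ, J, hJL, hJ⟩ := exists_resolvent hg
  have touch : ∀ ζ, ∀ z ∈ Ω, (∀ᶠ h in 𝓝 (0 : E),
      g (z + h) - θ (z + h) - ⟪ζ, h⟫ ≤ g z - θ z) →
      q z = θ' z + ζ ∧ ∀ᶠ h in 𝓝 (0 : E), ‖q (z + h) - q z‖ ≤ 4 * C * ‖h‖ := by
    intro ζ z hz hloc
    refine subgradient_of_touching hg hC ?_
    filter_upwards [hloc] with h hh
    have := hθ z hz h
    rw [inner_add_left]
    linarith
  set N : Set E := {s | ¬ DifferentiableAt ℝ J s} with hN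
  have hN0 : Measure.hausdorffMeasure (X := E) (Module.finrank ℝ E) N = 0 :=
    ae_iff.1 (hJL.ae_differentiableAt)
  by_cases hgood : ∃ ζ ∈ ball (0 : E) δ, ∃ z ∈ Ω, (∀ᶠ h in 𝓝 (0 : E),
      g (z + h) - θ (z + h) - ⟪ζ, h⟫ ≤ g z - θ z) ∧ DifferentiableAt ℝ J (z + q z)
  · obtain ⟨ζ, hζ, z, hz, hloc, hd⟩ := hgood
    obtain ⟨h1, h2⟩ := touch ζ z hz hloc
    obtain ⟨B, hB⟩ := subgradient_differentiable_of_resolvent hJ hd.hasFDerivAt h2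
    exact ⟨ζ, hζ, z, hz, hloc, h1, B, second_order_expansion_of_subgradient hg hB⟩
  · exfalso
    push Not at hgood
    set T : E → E := fun s => s - J s - θ' (J s) with hT
    have hTL : LipschitzOnWith (1 + KJ + K * KJ) T (N ∩ J ⁻¹' Ω) := by
      have h1 : LipschitzOnWith (K * KJ) (θ' ∘ J) (N ∩ J ⁻¹' Ω) :=
        hθ'.comp hJL.lipschitzOnWith (fun s hs => hs.2)
      exact ((LipschitzWith.id.sub hJL).lipschitzOnWith).sub h1
    have hsub : ball (0 : E) δ ⊆ T '' (N ∩ J ⁻¹' Ω) := by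
      intro ζ hζ
      obtain ⟨z, hz, hloc⟩ := hcontact ζ hζ
      refine ⟨z + q z, ⟨hgood ζ hζ z hz hloc, by rwa [mem_preimage, hJ]⟩, ?_⟩
      simp only [hT, hJ]
      rw [(touch ζ z hz hloc).1]
      abel
    have h0 : Measure.hausdorffMeasure (X := E) (Module.finrank ℝ E) (ball (0 : E) δ) = 0 := by
      refine measure_mono_null hsub (le_antisymm ?_ zero_le)
      refine (hTL.hausdorffMeasure_image_le (Nat.cast_nonneg _)).trans ?_
      rw [measure_mono_null inter_subset_left hN0, mul_zero]
    exact (measure_ball_pos _ _ hδ).ne' h0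

end Convex

section Penalty

variable {E V : Type*} [NormedAddCommGroup E] [InnerProductSpace ℝ E]
  [NormedAddCommGroup V] [InnerProductSpace ℝ V]

theorem norm_add_le_second_order {a b : V} (ha : a ≠ 0) :
    ‖a + b‖ ≤ ‖a‖ + ‖a‖⁻¹ * ⟪a, b⟫ + ‖b‖ ^ 2 / (2 * ‖a‖) := by
  have ha0 : 0 < ‖a‖ := norm_pos_iff.2 ha
  have h1 : ‖a + b‖ ^ 2 = ‖a‖ ^ 2 + 2 * ⟪a, b⟫ + ‖b‖ ^ 2 := norm_add_sq_real a b
  have h2 : ‖a‖ + ‖a‖⁻¹ * ⟪a, b⟫ + ‖b‖ ^ 2 / (2 * ‖a‖) = (‖a + b‖ ^ 2 + ‖a‖ ^ 2) / (2 * ‖a‖) := by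
    rw [h1]; field_simp; ring
  rw [h2, le_div_iff₀ (by positivity)]
  nlinarith [sq_nonneg (‖a + b‖ - ‖a‖)]

theorem norm_inv_smul_sub_le {a b : V} {d : ℝ} (hd : 0 < d) (ha : d ≤ ‖a‖) (hb : d ≤ ‖b‖) :
    ‖‖a‖⁻¹ • a - ‖b‖⁻¹ • b‖ ≤ 2 / d * ‖a - b‖ := by
  have ha0 : 0 < ‖a‖ := hd.trans_le ha
  have hb0 : 0 < ‖b‖ := hd.trans_le hb
  have h1 : ‖a‖⁻¹ • a - ‖b‖⁻¹ • b = ‖a‖⁻¹ • (a - b) + (‖a‖⁻¹ - ‖b‖⁻¹) • b := by module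
  have h2 : ‖(‖a‖⁻¹ - ‖b‖⁻¹) • b‖ ≤ ‖a‖⁻¹ * ‖a - b‖ := by
    rw [norm_smul, inv_sub_inv ha0.ne' hb0.ne', Real.norm_eq_abs, abs_div,
      abs_of_pos (mul_pos ha0 hb0), abs_sub_comm]
    calc |‖a‖ - ‖b‖| / (‖a‖ * ‖b‖) * ‖b‖ = ‖a‖⁻¹ * |‖a‖ - ‖b‖| := by field_simp
      _ ≤ _ := by gcongr; exact abs_norm_sub_norm_le a b
  have h3 : ‖a‖⁻¹ ≤ d⁻¹ := inv_anti₀ hd ha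
  calc _ ≤ ‖‖a‖⁻¹ • (a - b)‖ + ‖(‖a‖⁻¹ - ‖b‖⁻¹) • b‖ := by rw [h1]; exact norm_add_le _ _
    _ ≤ ‖a‖⁻¹ * ‖a - b‖ + ‖a‖⁻¹ * ‖a - b‖ := by
        gcongr; rw [norm_smul, Real.norm_of_nonneg (by positivity)]
    _ = 2 * ‖a‖⁻¹ * ‖a - b‖ := by ring
    _ ≤ 2 * d⁻¹ * ‖a - b‖ := by gcongr
    _ = _ := by ring

/-- The doubling penalization, with the quadratic term coming from the sup-convolution. -/
def penalty (D : E →L[ℝ] V) (z₀ : E) (m κ : ℝ) (z : E) : ℝ :=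
  m * (‖D z‖ - ‖D z‖ ^ 2 / 4) + κ * ‖z - z₀‖ ^ 2 + ‖z‖ ^ 2 / 2

theorem continuous_penalty (D : E →L[ℝ] V) (z₀ : E) (m κ : ℝ) : Continuous (penalty D z₀ m κ) := by
  unfold penalty
  fun_prop

variable [FiniteDimensional ℝ E] [FiniteDimensional ℝ V]

/-- The gradient of `penalty` away from the kernel of `D`. -/
def penaltyGrad (D : E →L[ℝ] V) (z₀ : E) (m κ : ℝ) (z : E) : E :=
  ContinuousLinearMap.adjoint D ((m * (‖D z‖⁻¹ - 1 / 2)) • D z) + (2 * κ) • (z - z₀) + z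

theorem penalty_add (D : E →L[ℝ] V) (z₀ : E) (m κ : ℝ) (z h : E) :
    penalty D z₀ m κ (z + h) = penalty D z₀ m κ z + ⟪penaltyGrad D z₀ m κ z, h⟫
      + m * (‖D z + D h‖ - ‖D z‖ - ‖D z‖⁻¹ * ⟪D z, D h⟫ - ‖D h‖ ^ 2 / 4)
      + (κ + 1 / 2) * ‖h‖ ^ 2 := by
  have h1 : ‖D z + D h‖ ^ 2 = ‖D z‖ ^ 2 + 2 * ⟪D z, D h⟫ + ‖D h‖ ^ 2 := norm_add_sq_real _ _
  have h2 : ‖z + h‖ ^ 2 = ‖z‖ ^ 2 + 2 * ⟪z, h⟫ + ‖h‖ ^ 2 := norm_add_sq_real _ _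
  have h3 : ‖z + h - z₀‖ ^ 2 = ‖z - z₀‖ ^ 2 + 2 * ⟪z - z₀, h⟫ + ‖h‖ ^ 2 := by
    rw [show z + h - z₀ = (z - z₀) + h by abel]; exact norm_add_sq_real _ _
  simp only [penalty, penaltyGrad, map_add, h1, h2, h3, inner_add_left, real_inner_smul_left,
    ContinuousLinearMap.adjoint_inner_left]
  ring

theorem penalty_add_le (D : E →L[ℝ] V) (z₀ : E) {m κ d : ℝ} (hm : 0 ≤ m) (hd : 0 < d) {z : E}
    (hz : d ≤ ‖D z‖) (h : E) :
    penalty D z₀ m κ (z + h) ≤ penalty D z₀ m κ z + ⟪penaltyGrad D z₀ m κ z, h⟫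
      + (m * (‖D‖ ^ 2 / (2 * d)) + (κ + 1 / 2)) * ‖h‖ ^ 2 := by
  have h0 : D z ≠ 0 := norm_pos_iff.1 (hd.trans_le hz)
  have h1 := norm_add_le_second_order (b := D h) h0
  have h2 : ‖D h‖ ^ 2 / (2 * ‖D z‖) ≤ ‖D‖ ^ 2 / (2 * d) * ‖h‖ ^ 2 := by
    calc _ ≤ (‖D‖ * ‖h‖) ^ 2 / (2 * d) := by gcongr; exact D.le_opNorm h
      _ = _ := by ring
  have h3 : m * (‖D z + D h‖ - ‖D z‖ - ‖D z‖⁻¹ * ⟪D z, D h⟫ - ‖D h‖ ^ 2 / 4)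
      ≤ m * (‖D‖ ^ 2 / (2 * d) * ‖h‖ ^ 2) :=
    mul_le_mul_of_nonneg_left (by nlinarith [sq_nonneg ‖D h‖]) hm
  rw [penalty_add]
  linarith

theorem lipschitzOnWith_penaltyGrad (D : E →L[ℝ] V) (z₀ : E) (m κ : ℝ) {d : ℝ} (hd : 0 < d) :
    ∃ K : NNReal, LipschitzOnWith K (penaltyGrad D z₀ m κ) {z | d ≤ ‖D z‖} := by
  have h1 : LipschitzOnWith (2 / d).toNNReal (fun a : V => ‖a‖⁻¹ • a) {a | d ≤ ‖a‖} := by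
    refine LipschitzOnWith.of_dist_le_mul fun a ha b hb => ?_
    rw [dist_eq_norm, dist_eq_norm, Real.coe_toNNReal _ (by positivity)]
    exact norm_inv_smul_sub_le hd ha hb
  have h2 : LipschitzOnWith _ (fun z : E => ContinuousLinearMap.adjoint D
      (m • (‖D z‖⁻¹ • D z))) {z | d ≤ ‖D z‖} :=
    ((ContinuousLinearMap.adjoint D).lipschitz.comp_lipschitzOnWith
      ((lipschitzWith_smul m).comp_lipschitzOnWith
        (h1.comp D.lipschitz.lipschitzOnWith fun z hz => hz)))
  let T : E →L[ℝ] E := (-(m / 2)) • ((ContinuousLinearMap.adjoint D).comp D)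
    + (2 * κ + 1) • ContinuousLinearMap.id ℝ E
  have h3 := (T.lipschitz.add (LipschitzWith.const (-((2 * κ) • z₀)))).lipschitzOnWith
    (s := {z | d ≤ ‖D z‖})
  suffices h : penaltyGrad D z₀ m κ = fun z => ContinuousLinearMap.adjoint D
      (m • (‖D z‖⁻¹ • D z)) + (T z + -((2 * κ) • z₀)) from ⟨_, h ▸ h2.add h3⟩
  funext z
  simp only [T, penaltyGrad, _root_.add_apply, _root_.smul_apply,
    ContinuousLinearMap.comp_apply, ContinuousLinearMap.id_apply, map_smul]
  module

end Penalty

section SupConvolution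

variable {V : Type*} [NormedAddCommGroup V] [InnerProductSpace ℝ V]

/-- The conjugate of a function on a compact set, together with a maximizer selection. -/
theorem exists_conjugate {K : Set V} (hK : IsCompact K) (hne : K.Nonempty) {c : V → ℝ}
    (hc : ContinuousOn c K) :
    ∃ (g : V → ℝ) (q : V → V), (∀ x, q x ∈ K) ∧ (∀ x, g x = ⟪x, q x⟫ + c (q x)) ∧
      ∀ x, ∀ w ∈ K, ⟪x, w⟫ + c w ≤ g x := by
  have : ∀ x : V, ∃ w ∈ K, IsMaxOn (fun w => ⟪x, w⟫ + c w) K w := fun x =>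
    hK.exists_isMaxOn hne ((continuous_const.inner continuous_id).continuousOn.add hc)
  choose q hq hmax using this
  exact ⟨fun x => ⟪x, q x⟫ + c (q x), q, hq, fun x => rfl, fun x w hw => hmax x hw⟩

theorem continuous_of_subgradient_bounded {g : V → ℝ} {q : V → V}
    (hg : ∀ z y, g z + ⟪q z, y - z⟫ ≤ g y) {R : NNReal} (hR : ∀ z, ‖q z‖ ≤ R) : Continuous g := by
  have key : ∀ z y, g y - g z ≤ R * dist y z := by
    intro z y
    have h1 := hg y z
    have h2 : ⟪q y, z - y⟫ = -⟪q y, y - z⟫ := by rw [← inner_neg_right, neg_sub]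
    have h3 := (real_inner_le_norm (q y) (y - z)).trans
      (mul_le_mul_of_nonneg_right (hR y) (norm_nonneg _))
    rw [dist_eq_norm]
    linarith
  refine (LipschitzWith.of_le_add_mul R fun x y => ?_).continuous
  have := key y x
  linarith

theorem exists_symmetric_restriction {E : Type*} [NormedAddCommGroup E] [InnerProductSpace ℝ E]
    [FiniteDimensional ℝ E] [FiniteDimensional ℝ V] (B : E →L[ℝ] E) (I : V →L[ℝ] E) :
    ∃ S : V →L[ℝ] V, (∀ x y, ⟪S x, y⟫ = ⟪x, S y⟫) ∧ ∀ a, ⟪S a, a⟫ = ⟪B (I a), I a⟫ := by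
  set T : V →L[ℝ] V := (ContinuousLinearMap.adjoint I).comp (B.comp I) with hT
  refine ⟨(1 / 2 : ℝ) • (T + ContinuousLinearMap.adjoint T), fun x y => ?_, fun a => ?_⟩
  · simp only [_root_.smul_apply, _root_.add_apply, real_inner_smul_left,
      real_inner_smul_right, inner_add_left, inner_add_right,
      ContinuousLinearMap.adjoint_inner_left, ContinuousLinearMap.adjoint_inner_right]
    ring
  · have h : ⟪T a, a⟫ = ⟪B (I a), I a⟫ := by
      simp only [hT, ContinuousLinearMap.comp_apply, ContinuousLinearMap.adjoint_inner_left]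
    simp only [_root_.smul_apply, _root_.add_apply, real_inner_smul_left,
      inner_add_left, ContinuousLinearMap.adjoint_inner_left, real_inner_comm (T a) a, h]
    ring

end SupConvolution

section Doubling

open Filter Topology

variable {V : Type*} [NormedAddCommGroup V] [InnerProductSpace ℝ V]

theorem exists_pos_smul_of_eventually {P : V → Prop} (h : ∀ᶠ x in 𝓝 (0 : V), P x) (v : V) :
    ∃ t > 0, P ((t : ℝ) • v) := by
  have h1 : Tendsto (fun t : ℝ => t • v) (𝓝[>] 0) (𝓝 0) := by
    have : Tendsto (fun t : ℝ => t • v) (𝓝 0) (𝓝 ((0 : ℝ) • v)) :=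
      (continuous_id.smul continuous_const).tendsto 0
    rw [zero_smul] at this
    exact this.mono_left nhdsWithin_le_nhds
  obtain ⟨t, ht, ht0⟩ := ((h1.eventually h).and self_mem_nhdsWithin).exists
  exact ⟨t, ht0, ht⟩

/-- The map `(x, y) ↦ x - y`. -/
def diffL (V : Type*) [NormedAddCommGroup V] [InnerProductSpace ℝ V] : WithLp 2 (V × V) →L[ℝ] V :=
  WithLp.fstL 2 ℝ V V - WithLp.sndL 2 ℝ V V

theorem diffL_apply (z : WithLp 2 (V × V)) : diffL V z = z.fst - z.snd := rfl

variable [FiniteDimensional ℝ V]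

theorem adjoint_diffL_fst (v : V) : (ContinuousLinearMap.adjoint (diffL V) v).fst = v := by
  refine ext_inner_right ℝ fun w => ?_
  have := ContinuousLinearMap.adjoint_inner_left (diffL V) (WithLp.toLp 2 (w, (0 : V))) v
  rw [WithLp.prod_inner_apply] at this
  simpa [diffL_apply] using this

theorem adjoint_diffL_snd (v : V) : (ContinuousLinearMap.adjoint (diffL V) v).snd = -v := by
  refine ext_inner_right ℝ fun w => ?_
  have := ContinuousLinearMap.adjoint_inner_left (diffL V) (WithLp.toLp 2 ((0 : V), w)) v
  rw [WithLp.prod_inner_apply] at this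
  simpa [diffL_apply] using this

/-- Sup-convolution of a bounded function, written as `g x - ‖x‖ ^ 2 / 2` with `g` convex. -/
theorem exists_sup_convolution {r : ℝ} (hr : 0 < r) {v : V → ℝ}
    (hv : ContinuousOn v (closedBall 0 r)) (hv1 : ∀ x ∈ closedBall (0 : V) r, |v x| ≤ 1)
    {s : ℝ} (hs : 0 < s) :
    ∃ (g : V → ℝ) (q : V → V), Continuous g ∧ (∀ x, q x ∈ closedBall (0 : V) r) ∧
      (∀ z y, g z + ⟪q z, y - z⟫ ≤ g y) ∧
      (∀ x, g x - ‖x‖ ^ 2 / 2 = s ^ 2 * v (q x) - ‖x - q x‖ ^ 2 / 2) ∧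
      (∀ x ∈ closedBall (0 : V) r, s ^ 2 * v x ≤ g x - ‖x‖ ^ 2 / 2) ∧
      (∀ x ∈ closedBall (0 : V) r, ‖x - q x‖ ≤ 2 * s) ∧
      ∀ x a, q x + a ∈ closedBall (0 : V) r →
        s ^ 2 * v (q x + a) ≤ s ^ 2 * v (q x) + (g (x + a) - g x) - ⟪x, a⟫ - ‖a‖ ^ 2 / 2 := by
  obtain ⟨g, q, hq, hgq, hmax⟩ := exists_conjugate (c := fun w => s ^ 2 * v w - ‖w‖ ^ 2 / 2)
    (isCompact_closedBall (0 : V) r) (nonempty_closedBall.2 hr.le)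
    ((continuousOn_const.mul hv).sub (by fun_prop))
  have hsub : ∀ z y, g z + ⟪q z, y - z⟫ ≤ g y := by
    intro z y
    have h1 := hmax y (q z) (hq z)
    rw [hgq z, inner_sub_right, real_inner_comm (q z) z]
    rw [real_inner_comm] at h1
    linarith
  have hval : ∀ x, g x - ‖x‖ ^ 2 / 2 = s ^ 2 * v (q x) - ‖x - q x‖ ^ 2 / 2 := by
    intro x
    rw [hgq, norm_sub_sq_real]
    ring
  have hlow : ∀ x ∈ closedBall (0 : V) r, s ^ 2 * v x ≤ g x - ‖x‖ ^ 2 / 2 := by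
    intro x hx
    have := hmax x x hx
    rw [real_inner_self_eq_norm_sq] at this
    linarith
  refine ⟨g, q, ?_, hq, hsub, hval, hlow, fun x hx => ?_, fun x a ha => ?_⟩
  · refine continuous_of_subgradient_bounded hsub (R := ⟨r, hr.le⟩) fun z => ?_
    exact mem_closedBall_zero_iff.1 (hq z)
  · have h1 := hlow x hx
    rw [hval] at h1
    have h2 := abs_le.1 (hv1 x hx)
    have h3 := abs_le.1 (hv1 _ (hq x))
    refine abs_le_of_sq_le_sq' ?_ (by positivity) |>.2
    nlinarith [sq_nonneg s]
  · have h1 := hmax (x + a) (q x + a) ha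
    have h2 := hgq x
    have h3 : ‖q x + a‖ ^ 2 = ‖q x‖ ^ 2 + 2 * ⟪q x, a⟫ + ‖a‖ ^ 2 := norm_add_sq_real _ _
    have h4 : ⟪x + a, q x + a⟫ = ⟪x, q x⟫ + ⟪x, a⟫ + ⟪q x, a⟫ + ‖a‖ ^ 2 := by
      rw [inner_add_left, inner_add_right, inner_add_right, real_inner_self_eq_norm_sq,
        real_inner_comm (q x) a]
      ring
    rw [h4, h3] at h1
    linarith

/-- The doubled sup-convolution touches tilted penalties from below, in the interior and away from
the diagonal. -/
theorem exists_contact {u g₁ g₂ : V → ℝ} {q₁ q₂ : V → V} {x₀ y₀ : V} {s d γ L : ℝ}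
    (hs : 0 < s) (hL : 0 ≤ L) (hγ : 0 < γ)
    (hx₀ : x₀ ∈ ball (0 : V) (1 / 2)) (hy₀ : y₀ ∈ ball (0 : V) (1 / 2))
    (hγu : γ ≤ u x₀ - u y₀ - L * ‖x₀ - y₀‖)
    (hsd : 8 * s ≤ d)
    (hu1 : ∀ x ∈ closedBall (0 : V) (7 / 8), |u x| ≤ 1)
    (huc : ∀ x ∈ closedBall (0 : V) (7 / 8), ∀ y ∈ closedBall (0 : V) (7 / 8), dist x y < d →
      u x - u y < γ / 2)
    (hc₁ : Continuous g₁) (hc₂ : Continuous g₂)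
    (hq₁ : ∀ x, q₁ x ∈ closedBall (0 : V) (7 / 8)) (hq₂ : ∀ x, q₂ x ∈ closedBall (0 : V) (7 / 8))
    (hv₁ : ∀ x, g₁ x - ‖x‖ ^ 2 / 2 = s ^ 2 * u (q₁ x) - ‖x - q₁ x‖ ^ 2 / 2)
    (hv₂ : ∀ x, g₂ x - ‖x‖ ^ 2 / 2 = s ^ 2 * (-u (q₂ x)) - ‖x - q₂ x‖ ^ 2 / 2)
    (hl₁ : ∀ x ∈ closedBall (0 : V) (7 / 8), s ^ 2 * u x ≤ g₁ x - ‖x‖ ^ 2 / 2)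
    (hl₂ : ∀ x ∈ closedBall (0 : V) (7 / 8), s ^ 2 * (-u x) ≤ g₂ x - ‖x‖ ^ 2 / 2)
    (hn₁ : ∀ x ∈ closedBall (0 : V) (7 / 8), ‖x - q₁ x‖ ≤ 2 * s)
    (hn₂ : ∀ x ∈ closedBall (0 : V) (7 / 8), ‖x - q₂ x‖ ≤ 2 * s)
    {ζ : WithLp 2 (V × V)} (hζ : ‖ζ‖ ≤ s ^ 2 * γ) :
    ∃ z ∈ ball (WithLp.toLp 2 (x₀, y₀)) (1 / 4) ∩ {z | d / 2 ≤ ‖diffL V z‖},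
      ∀ᶠ h in 𝓝 (0 : WithLp 2 (V × V)), (g₁ (z + h).fst + g₂ (z + h).snd)
        - penalty (diffL V) (WithLp.toLp 2 (x₀, y₀)) (s ^ 2 * L) (s ^ 2 * 32) (z + h) - ⟪ζ, h⟫
        ≤ (g₁ z.fst + g₂ z.snd)
          - penalty (diffL V) (WithLp.toLp 2 (x₀, y₀)) (s ^ 2 * L) (s ^ 2 * 32) z := by
  set z₀ : WithLp 2 (V × V) := WithLp.toLp 2 (x₀, y₀) with hz₀
  set θ := penalty (diffL V) z₀ (s ^ 2 * L) (s ^ 2 * 32) with hθ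
  have hs2 : 0 < s ^ 2 := by positivity
  rw [mem_ball_zero_iff] at hx₀ hy₀
  have hcf : Continuous fun z : WithLp 2 (V × V) => z.fst := (WithLp.fstL 2 ℝ V V).continuous
  have hcs : Continuous fun z : WithLp 2 (V × V) => z.snd := (WithLp.sndL 2 ℝ V V).continuous
  have hcont : Continuous fun z : WithLp 2 (V × V) =>
      (g₁ z.fst + g₂ z.snd) - θ z - ⟪ζ, z⟫ :=
    (((hc₁.comp hcf).add (hc₂.comp hcs)).sub (continuous_penalty _ _ _ _)).sub
      (continuous_const.inner continuous_id)
  obtain ⟨z, hz, hmax⟩ := (isCompact_closedBall z₀ (1 / 4)).exists_isMaxOn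
    (nonempty_closedBall.2 (by norm_num)) hcont.continuousOn
  rw [mem_closedBall, dist_eq_norm] at hz
  have hx : ‖z.fst‖ < 3 / 4 := by
    have h1 := (WithLp.norm_fst_le _ (z - z₀)).trans hz
    have h2 : z.fst = (z - z₀).fst + x₀ := by simp [hz₀]
    rw [h2]
    exact (norm_add_le _ _).trans_lt (by linarith)
  have hy : ‖z.snd‖ < 3 / 4 := by
    have h1 := (WithLp.norm_snd_le _ (z - z₀)).trans hz
    have h2 : z.snd = (z - z₀).snd + y₀ := by simp [hz₀]
    rw [h2]
    exact (norm_add_le _ _).trans_lt (by linarith)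
  have hxK : z.fst ∈ closedBall (0 : V) (7 / 8) := by rw [mem_closedBall_zero_iff]; linarith
  have hyK : z.snd ∈ closedBall (0 : V) (7 / 8) := by rw [mem_closedBall_zero_iff]; linarith
  have hD : ‖diffL V z‖ ≤ 2 := (norm_sub_le z.fst z.snd).trans (by linarith)
  have hP : 0 ≤ s ^ 2 * L * (‖diffL V z‖ - ‖diffL V z‖ ^ 2 / 4) :=
    mul_nonneg (by positivity) (by nlinarith [norm_nonneg (diffL V z)])
  have hnz : ‖z‖ ^ 2 = ‖z.fst‖ ^ 2 + ‖z.snd‖ ^ 2 := WithLp.prod_norm_sq_eq_of_L2 z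
  have hmain : s ^ 2 * γ / 2 < (g₁ z.fst + g₂ z.snd) - θ z := by
    have h1 : (g₁ x₀ + g₂ y₀) - θ z₀ - ⟪ζ, z₀⟫ ≤ (g₁ z.fst + g₂ z.snd) - θ z - ⟪ζ, z⟫ :=
      hmax (mem_closedBall_self (by norm_num))
    have h2 := hl₁ x₀ (by rw [mem_closedBall_zero_iff]; linarith)
    have h3 := hl₂ y₀ (by rw [mem_closedBall_zero_iff]; linarith)
    have h4 : θ z₀ = s ^ 2 * L * (‖x₀ - y₀‖ - ‖x₀ - y₀‖ ^ 2 / 4) + (‖x₀‖ ^ 2 + ‖y₀‖ ^ 2) / 2 := by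
      simp only [hθ, penalty, WithLp.prod_norm_sq_eq_of_L2 z₀, diffL_apply]
      simp [hz₀]
    have h5 : s ^ 2 * γ ≤ s ^ 2 * (u x₀ - u y₀ - L * ‖x₀ - y₀‖) := by gcongr
    have h6 : 0 ≤ s ^ 2 * L * (‖x₀ - y₀‖ ^ 2 / 4) := by positivity
    have h7 : -(⟪ζ, z⟫ - ⟪ζ, z₀⟫) ≤ s ^ 2 * γ * (1 / 4) := by
      rw [← inner_sub_right]
      refine (neg_le_abs _).trans ((abs_real_inner_le_norm _ _).trans ?_)
      gcongr
    have h8 : 0 < s ^ 2 * γ := by positivity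
    nlinarith
  have hval : (g₁ z.fst + g₂ z.snd) - θ z = s ^ 2 * (u (q₁ z.fst) - u (q₂ z.snd))
      - ‖z.fst - q₁ z.fst‖ ^ 2 / 2 - ‖z.snd - q₂ z.snd‖ ^ 2 / 2
      - s ^ 2 * L * (‖diffL V z‖ - ‖diffL V z‖ ^ 2 / 4) - s ^ 2 * 32 * ‖z - z₀‖ ^ 2 := by
    have h1 := hv₁ z.fst
    have h2 := hv₂ z.snd
    simp only [hθ, penalty, hnz]
    linarith
  have hn1 := sq_nonneg ‖z.fst - q₁ z.fst‖
  have hn2 := sq_nonneg ‖z.snd - q₂ z.snd‖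
  have hint : z ∈ ball z₀ (1 / 4) := by
    rw [mem_ball, dist_eq_norm]
    refine lt_of_le_of_ne hz fun heq => ?_
    rw [hval, heq] at hmain
    have h1 := abs_le.1 (hu1 _ (hq₁ z.fst))
    have h2 := abs_le.1 (hu1 _ (hq₂ z.snd))
    have h3 : s ^ 2 * (u (q₁ z.fst) - u (q₂ z.snd)) ≤ s ^ 2 * 2 := by gcongr; linarith
    have h8 : 0 < s ^ 2 * γ := by positivity
    nlinarith
  refine ⟨z, ⟨hint, ?_⟩, ?_⟩
  · change d / 2 ≤ ‖diffL V z‖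
    by_contra! hlt
    have h1 : dist (q₁ z.fst) (q₂ z.snd) < d := by
      rw [dist_eq_norm]
      have e : q₁ z.fst - q₂ z.snd
          = diffL V z - (z.fst - q₁ z.fst) + (z.snd - q₂ z.snd) := by
        rw [diffL_apply]; abel
      have h2 := hn₁ _ hxK
      have h3 := hn₂ _ hyK
      rw [e]
      calc _ ≤ ‖diffL V z‖ + ‖z.fst - q₁ z.fst‖ + ‖z.snd - q₂ z.snd‖ :=
            (norm_add_le _ _).trans (by gcongr; exact norm_sub_le _ _)
        _ < d := by linarith
    have h2 : s ^ 2 * (u (q₁ z.fst) - u (q₂ z.snd)) ≤ s ^ 2 * (γ / 2) := by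
      gcongr
      exact (huc _ (hq₁ _) _ (hq₂ _) h1).le
    have h3 : 0 ≤ s ^ 2 * 32 * ‖z - z₀‖ ^ 2 := by positivity
    rw [hval] at hmain
    linarith
  · have h1 : Tendsto (fun h => z + h) (𝓝 0) (𝓝 z) := by
      simpa using (continuous_const_add z).tendsto 0
    filter_upwards [h1.eventually (isOpen_ball.mem_nhds hint)] with h hh
    have h2 : (g₁ (z + h).fst + g₂ (z + h).snd) - θ (z + h) - ⟪ζ, z + h⟫
        ≤ (g₁ z.fst + g₂ z.snd) - θ z - ⟪ζ, z⟫ := hmax (ball_subset_closedBall hh)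
    rw [inner_add_right] at h2
    linarith

omit [FiniteDimensional ℝ V] in
theorem upper_jet_of_sup_convolution {r s τ : ℝ} (hs : s ≠ 0) {v g : V → ℝ} {x w : V}
    {S : V →L[ℝ] V} (hw : ‖w‖ < r)
    (hj : ∀ a, w + a ∈ closedBall (0 : V) r →
      s ^ 2 * v (w + a) ≤ s ^ 2 * v w + (g (x + a) - g x) - ⟪x, a⟫ - ‖a‖ ^ 2 / 2)
    (hS : ∀ᶠ a in 𝓝 (0 : V), |g (x + a) - g x - ⟪w, a⟫ - 1 / 2 * ⟪S a, a⟫| ≤ τ * ‖a‖ ^ 2) :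
    ∀ᶠ a in 𝓝 (0 : V), v (w + a) ≤ v w + ⟪(s ^ 2)⁻¹ • (w - x), a⟫
      + ⟪((s ^ 2)⁻¹ • (S + (2 * τ - 1) • ContinuousLinearMap.id ℝ V)) a, a⟫ / 2 := by
  have h1 : Tendsto (fun a => w + a) (𝓝 0) (𝓝 w) := by
    simpa using (continuous_const_add w).tendsto 0
  have h2 : ∀ᶠ a in 𝓝 (0 : V), w + a ∈ closedBall (0 : V) r :=
    h1.eventually (closedBall_mem_nhds_of_mem (by simpa using hw))
  filter_upwards [h2, hS] with a ha hSa
  have h3 := hj a ha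
  have h4 := (abs_le.1 hSa).2
  have hs2 : 0 < s ^ 2 := by positivity
  refine le_of_mul_le_mul_left ?_ hs2
  simp only [_root_.smul_apply, _root_.add_apply, ContinuousLinearMap.id_apply,
    real_inner_smul_left, inner_add_left, inner_sub_left, real_inner_self_eq_norm_sq]
  have h5 : s ^ 2 * (v w + (s ^ 2)⁻¹ * (⟪w, a⟫ - ⟪x, a⟫)
      + (s ^ 2)⁻¹ * (⟪S a, a⟫ + (2 * τ - 1) * ‖a‖ ^ 2) / 2)
      = s ^ 2 * v w + (⟪w, a⟫ - ⟪x, a⟫) + (⟪S a, a⟫ + (2 * τ - 1) * ‖a‖ ^ 2) / 2 := by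
    field_simp
  rw [h5]
  linarith

omit [FiniteDimensional ℝ V] in
theorem second_order_bounds_of_doubling {S₁ S₂ : V →L[ℝ] V} {τ m κ : ℝ} {b : V} (hb : b ≠ 0)
    (hR : ∀ᶠ h in 𝓝 (0 : WithLp 2 (V × V)),
      ⟪S₁ h.fst, h.fst⟫ / 2 + ⟪S₂ h.snd, h.snd⟫ / 2 - τ * ‖h‖ ^ 2
      ≤ m * (‖b + diffL V h‖ - ‖b‖ - ‖b‖⁻¹ * ⟪b, diffL V h⟫ - ‖diffL V h‖ ^ 2 / 4)
        + κ * ‖h‖ ^ 2) :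
    (∀ a, ⟪(S₁ + S₂) a, a⟫ ≤ 4 * (κ + τ) * ‖a‖ ^ 2) ∧
      ∃ e : V, ‖e‖ = 1 ∧ ⟪(S₁ + S₂) e, e⟫ ≤ 4 * (κ + τ) - 2 * m := by
  have hb0 : 0 < ‖b‖ := norm_pos_iff.2 hb
  refine ⟨fun a => ?_, ‖b‖⁻¹ • b, norm_smul_inv_norm hb, ?_⟩
  · obtain ⟨t, ht, h⟩ := exists_pos_smul_of_eventually hR (WithLp.toLp 2 (a, a))
    simp only [diffL_apply, WithLp.smul_fst, WithLp.smul_snd, WithLp.toLp_fst, WithLp.toLp_snd, WithLp.prod_norm_sq_eq_of_L2,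
      map_smul, real_inner_smul_left, real_inner_smul_right, norm_smul, mul_pow,
      Real.norm_of_nonneg ht.le, sub_self, smul_zero, norm_zero, inner_zero_right, add_zero] at h
    rw [_root_.add_apply, inner_add_left]
    have ht2 : 0 < t ^ 2 := by positivity
    refine le_of_mul_le_mul_left ?_ ht2
    linarith
  · set e := ‖b‖⁻¹ • b with he
    have he1 : ‖e‖ = 1 := norm_smul_inv_norm hb
    have hbe : b = ‖b‖ • e := by rw [he, smul_smul, mul_inv_cancel₀ hb0.ne', one_smul]
    obtain ⟨t, ht, h⟩ := exists_pos_smul_of_eventually hR (WithLp.toLp 2 (e, -e))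
    have h1 : diffL V (t • WithLp.toLp 2 (e, -e)) = (2 * t) • e := by
      simp only [diffL_apply, WithLp.smul_fst, WithLp.smul_snd, WithLp.toLp_fst, WithLp.toLp_snd]
      module
    have h2 : ‖b + (2 * t) • e‖ = ‖b‖ + 2 * t := by
      conv_lhs => rw [hbe, ← add_smul, norm_smul, he1, mul_one]
      exact Real.norm_of_nonneg (by positivity)
    have h3 : ⟪b, (2 * t) • e⟫ = 2 * t * ‖b‖ := by
      conv_lhs => rw [hbe, real_inner_smul_left, real_inner_smul_right,
        real_inner_self_eq_norm_sq, he1]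
      ring
    have h4 : ‖(2 * t) • e‖ = 2 * t := by
      rw [norm_smul, he1, mul_one, Real.norm_of_nonneg (by positivity)]
    have h5 : ‖b‖⁻¹ * (2 * t * ‖b‖) = 2 * t := by field_simp
    rw [h1, h2, h3, h4, h5] at h
    simp only [WithLp.smul_fst, WithLp.smul_snd, WithLp.toLp_fst, WithLp.toLp_snd, WithLp.prod_norm_sq_eq_of_L2,
      map_smul, map_neg, real_inner_smul_left, real_inner_smul_right, norm_smul, mul_pow,
      Real.norm_of_nonneg ht.le, inner_neg_neg, norm_neg, he1, one_pow] at h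
    rw [_root_.add_apply, inner_add_left]
    have ht2 : 0 < t ^ 2 := by positivity
    refine le_of_mul_le_mul_left ?_ ht2
    linarith

omit [FiniteDimensional ℝ V] in
theorem one_le_norm_smul_add {L : ℝ} (hL : 72 ≤ L) {a w : V} (ha : a ≠ 0) (ha2 : ‖a‖ ≤ 3 / 2)
    (hw : ‖w‖ ≤ 17) : 1 ≤ ‖(L * (‖a‖⁻¹ - 1 / 2)) • a + w‖ := by
  have ha0 : 0 < ‖a‖ := norm_pos_iff.2 ha
  have h1 : (1 : ℝ) / 2 ≤ ‖a‖⁻¹ := by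
    rw [one_div]; exact inv_anti₀ ha0 (by linarith)
  have h2 : ‖(L * (‖a‖⁻¹ - 1 / 2)) • a‖ = L * (1 - ‖a‖ / 2) := by
    rw [norm_smul, Real.norm_of_nonneg (mul_nonneg (by linarith) (by linarith))]
    field_simp
  have h3 := norm_sub_le ((L * (‖a‖⁻¹ - 1 / 2)) • a + w) w
  rw [add_sub_cancel_right, h2] at h3
  nlinarith

/-- If a bounded function violates a Lipschitz estimate, then at some pair of points it has second
order jets with large slopes whose Hessians differ by a very negative matrix. -/
theorem exists_doubling_jets {u : V → ℝ} (hu : ContinuousOn u (ball 0 1))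
    (hu1 : ∀ x ∈ ball (0 : V) 1, |u x| ≤ 1) {x₀ y₀ : V} {L : ℝ} (hL : 72 ≤ L)
    (hx₀ : x₀ ∈ ball (0 : V) (1 / 2)) (hy₀ : y₀ ∈ ball (0 : V) (1 / 2))
    (hlt : L * ‖x₀ - y₀‖ < u x₀ - u y₀) :
    ∃ x ∈ ball (0 : V) 1, ∃ y ∈ ball (0 : V) 1, ∃ (p₁ p₂ : V) (X Y : V →L[ℝ] V),
      1 ≤ ‖p₁‖ ∧ 1 ≤ ‖p₂‖ ∧
      (∀ v w, ⟪X v, w⟫ = ⟪v, X w⟫) ∧ (∀ v w, ⟪Y v, w⟫ = ⟪v, Y w⟫) ∧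
      (∀ᶠ a in 𝓝 (0 : V), u (x + a) ≤ u x + ⟪p₁, a⟫ + ⟪X a, a⟫ / 2) ∧
      (∀ᶠ a in 𝓝 (0 : V), u y + ⟪p₂, a⟫ + ⟪Y a, a⟫ / 2 ≤ u (y + a)) ∧
      (∀ a, ⟪(X - Y) a, a⟫ ≤ 129 * ‖a‖ ^ 2) ∧
      ∃ e : V, ‖e‖ = 1 ∧ ⟪(X - Y) e, e⟫ ≤ 129 - 2 * L := by
  have hKB : closedBall (0 : V) (7 / 8) ⊆ ball 0 1 := closedBall_subset_ball (by norm_num)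
  set γ := u x₀ - u y₀ - L * ‖x₀ - y₀‖ with hγdef
  have hγ : 0 < γ := by rw [hγdef]; linarith
  have huK := hu.mono hKB
  obtain ⟨d, hd, huc⟩ := Metric.uniformContinuousOn_iff.1
    ((isCompact_closedBall (0 : V) (7 / 8)).uniformContinuousOn_of_continuous huK) (γ / 2)
    (by positivity)
  obtain ⟨s, hs, hsd, hs16⟩ : ∃ s : ℝ, 0 < s ∧ 8 * s ≤ d ∧ 32 * s ≤ 1 :=
    ⟨min (d / 8) (1 / 32), by positivity, by linarith [min_le_left (d / 8) (1 / 32)],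
      by linarith [min_le_right (d / 8) (1 / 32)]⟩
  have hs2 : 0 < s ^ 2 := by positivity
  obtain ⟨g₁, q₁, hc₁, hq₁, hg₁, hv₁, hl₁, hn₁, hj₁⟩ := exists_sup_convolution
    (r := 7 / 8) (by norm_num) huK (fun x hx => hu1 x (hKB hx)) hs
  obtain ⟨g₂, q₂, hc₂, hq₂, hg₂, hv₂, hl₂, hn₂, hj₂⟩ := exists_sup_convolution (v := fun x => -u x)
    (r := 7 / 8) (by norm_num) huK.neg (fun x hx => by rw [abs_neg]; exact hu1 x (hKB hx)) hs
  set z₀ : WithLp 2 (V × V) := WithLp.toLp 2 (x₀, y₀) with hz₀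
  obtain ⟨K, hK⟩ := lipschitzOnWith_penaltyGrad (diffL V) z₀ (s ^ 2 * L) (s ^ 2 * 32)
    (half_pos hd)
  obtain ⟨ζ, hζ, z, hz, hloc, hqz, B, hB⟩ := exists_contact_second_order
    (g := fun z : WithLp 2 (V × V) => g₁ z.fst + g₂ z.snd)
    (q := fun z => WithLp.toLp 2 (q₁ z.fst, q₂ z.snd))
    (θ := penalty (diffL V) z₀ (s ^ 2 * L) (s ^ 2 * 32))
    (θ' := penaltyGrad (diffL V) z₀ (s ^ 2 * L) (s ^ 2 * 32))
    (Ω := ball z₀ (1 / 4) ∩ {z | d / 2 ≤ ‖diffL V z‖})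
    (C := s ^ 2 * L * (‖diffL V‖ ^ 2 / (2 * (d / 2))) + (s ^ 2 * 32 + 1 / 2))
    (δ := min (s ^ 2) (s ^ 2 * γ)) (by positivity) (by positivity)
    (fun z y => by
      have h1 := hg₁ z.fst y.fst
      have h2 := hg₂ z.snd y.snd
      rw [WithLp.prod_inner_apply]
      change g₁ z.fst + g₂ z.snd + (⟪q₁ z.fst, y.fst - z.fst⟫ + ⟪q₂ z.snd, y.snd - z.snd⟫) ≤ _
      linarith)
    (hK.mono inter_subset_right)
    (fun z hz h => penalty_add_le _ _ (by positivity) (half_pos hd) hz.2 h)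
    (fun ζ hζ => exists_contact hs (by linarith) hγ hx₀ hy₀ hγdef.le hsd
      (fun x hx => hu1 x (hKB hx))
      (fun x hx y hy hxy => (le_abs_self _).trans_lt (by
        have := huc x hx y hy hxy
        rwa [Real.dist_eq] at this)) hc₁ hc₂ hq₁ hq₂ hv₁ hv₂ hl₁ hl₂ hn₁ hn₂
      ((mem_ball_zero_iff.1 hζ).le.trans (min_le_right _ _)))
  set b := diffL V z with hbdef
  have hb : b ≠ 0 := norm_pos_iff.1 ((half_pos hd).trans_le hz.2)
  have hw := mem_ball_iff_norm.1 hz.1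
  rw [mem_ball_zero_iff] at hx₀ hy₀ hζ
  have hwx : ‖z.fst - x₀‖ < 1 / 4 := (WithLp.norm_fst_le _ (z - z₀)).trans_lt hw
  have hwy : ‖z.snd - y₀‖ < 1 / 4 := (WithLp.norm_snd_le _ (z - z₀)).trans_lt hw
  have hzx : ‖z.fst‖ < 3 / 4 := by
    have := norm_add_le (z.fst - x₀) x₀
    rw [sub_add_cancel] at this
    linarith
  have hzy : ‖z.snd‖ < 3 / 4 := by
    have := norm_add_le (z.snd - y₀) y₀
    rw [sub_add_cancel] at this
    linarith
  have hb2 : ‖b‖ ≤ 3 / 2 := (norm_sub_le z.fst z.snd).trans (by linarith)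
  have hq₁z : ‖q₁ z.fst‖ < 7 / 8 := by
    have h1 := hn₁ z.fst (by rw [mem_closedBall_zero_iff]; linarith)
    have h2 := norm_sub_le z.fst (z.fst - q₁ z.fst)
    rw [sub_sub_cancel] at h2
    linarith
  have hq₂z : ‖q₂ z.snd‖ < 7 / 8 := by
    have h1 := hn₂ z.snd (by rw [mem_closedBall_zero_iff]; linarith)
    have h2 := norm_sub_le z.snd (z.snd - q₂ z.snd)
    rw [sub_sub_cancel] at h2
    linarith
  let I := (WithLp.prodContinuousLinearEquiv 2 ℝ V V).symm.toContinuousLinearMap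
  obtain ⟨S₁, hS₁, hBS₁⟩ := exists_symmetric_restriction B (I ∘L ContinuousLinearMap.inl ℝ V V)
  obtain ⟨S₂, hS₂, hBS₂⟩ := exists_symmetric_restriction B (I ∘L ContinuousLinearMap.inr ℝ V V)
  have hτ : 0 < s ^ 2 / 8 := by positivity
  have hE₁ : ∀ᶠ a in 𝓝 (0 : V), |g₁ (z.fst + a) - g₁ z.fst - ⟪q₁ z.fst, a⟫
      - 1 / 2 * ⟪S₁ a, a⟫| ≤ s ^ 2 / 8 * ‖a‖ ^ 2 := by
    have h1 : Tendsto (I ∘L ContinuousLinearMap.inl ℝ V V) (𝓝 0) (𝓝 0) :=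
      ((I ∘L ContinuousLinearMap.inl ℝ V V).continuous.tendsto' 0 0 (map_zero _))
    filter_upwards [h1.eventually (hB _ hτ)] with a ha
    rw [← hBS₁, WithLp.prod_norm_sq_eq_of_L2, WithLp.prod_inner_apply] at ha
    simpa [I] using ha
  have hE₂ : ∀ᶠ a in 𝓝 (0 : V), |g₂ (z.snd + a) - g₂ z.snd - ⟪q₂ z.snd, a⟫
      - 1 / 2 * ⟪S₂ a, a⟫| ≤ s ^ 2 / 8 * ‖a‖ ^ 2 := by
    have h1 : Tendsto (I ∘L ContinuousLinearMap.inr ℝ V V) (𝓝 0) (𝓝 0) :=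
      ((I ∘L ContinuousLinearMap.inr ℝ V V).continuous.tendsto' 0 0 (map_zero _))
    filter_upwards [h1.eventually (hB _ hτ)] with a ha
    rw [← hBS₂, WithLp.prod_norm_sq_eq_of_L2, WithLp.prod_inner_apply] at ha
    simpa [I] using ha
  have hR : ∀ᶠ h in 𝓝 (0 : WithLp 2 (V × V)),
      ⟪S₁ h.fst, h.fst⟫ / 2 + ⟪S₂ h.snd, h.snd⟫ / 2 - s ^ 2 / 8 * ‖h‖ ^ 2
      ≤ s ^ 2 * L * (‖b + diffL V h‖ - ‖b‖ - ‖b‖⁻¹ * ⟪b, diffL V h⟫ - ‖diffL V h‖ ^ 2 / 4)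
        + (s ^ 2 * 32 + 1 / 2) * ‖h‖ ^ 2 := by
    have h1 : Tendsto (fun h : WithLp 2 (V × V) => h.fst) (𝓝 0) (𝓝 0) :=
      (WithLp.fstL 2 ℝ V V).continuous.tendsto' 0 0 (map_zero _)
    have h2 : Tendsto (fun h : WithLp 2 (V × V) => h.snd) (𝓝 0) (𝓝 0) :=
      (WithLp.sndL 2 ℝ V V).continuous.tendsto' 0 0 (map_zero _)
    filter_upwards [hloc, h1.eventually hE₁, h2.eventually hE₂] with h hh ha₁ ha₂
    rw [penalty_add] at hh
    have h3 : ⟪q₁ z.fst, h.fst⟫ + ⟪q₂ z.snd, h.snd⟫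
        = ⟪penaltyGrad (diffL V) z₀ (s ^ 2 * L) (s ^ 2 * 32) z, h⟫ + ⟪ζ, h⟫ := by
      rw [← inner_add_left, ← hqz, WithLp.prod_inner_apply]
      rfl
    have h4 := (abs_le.1 ha₁).1
    have h5 := (abs_le.1 ha₂).1
    rw [WithLp.add_fst, WithLp.add_snd] at hh
    rw [WithLp.prod_norm_sq_eq_of_L2] at hh ⊢
    linarith
  obtain ⟨hup, e, he, hdown⟩ := second_order_bounds_of_doubling hb hR
  have hp₁ : (s ^ 2)⁻¹ • (q₁ z.fst - z.fst) = (L * (‖b‖⁻¹ - 1 / 2)) • b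
      + ((64 : ℝ) • (z.fst - x₀) + (s ^ 2)⁻¹ • ζ.fst) := by
    have h1 : q₁ z.fst = (s ^ 2 * L * (‖b‖⁻¹ - 1 / 2)) • b + (2 * (s ^ 2 * 32)) • (z.fst - x₀)
        + z.fst + ζ.fst := by
      have := congrArg (fun w : WithLp 2 (V × V) => w.fst) hqz
      simpa [penaltyGrad, adjoint_diffL_fst, -map_smul, hz₀] using this
    rw [h1, inv_smul_eq_iff₀ hs2.ne']
    simp only [smul_add, smul_smul, mul_inv_cancel₀ hs2.ne', one_smul]
    module
  have hp₂ : -((s ^ 2)⁻¹ • (q₂ z.snd - z.snd)) = (L * (‖b‖⁻¹ - 1 / 2)) • b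
      + ((-64 : ℝ) • (z.snd - y₀) + (-(s ^ 2)⁻¹) • ζ.snd) := by
    have h1 : q₂ z.snd = -((s ^ 2 * L * (‖b‖⁻¹ - 1 / 2)) • b) + (2 * (s ^ 2 * 32)) • (z.snd - y₀)
        + z.snd + ζ.snd := by
      have := congrArg (fun w : WithLp 2 (V × V) => w.snd) hqz
      simpa [penaltyGrad, adjoint_diffL_snd, -map_smul, hz₀] using this
    rw [← smul_neg, h1, inv_smul_eq_iff₀ hs2.ne']
    simp only [smul_add, smul_smul, neg_smul, smul_neg, mul_inv_cancel₀ hs2.ne', one_smul]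
    module
  have hζs : ‖ζ‖ ≤ s ^ 2 := hζ.le.trans (min_le_left _ _)
  have hζ₁ : (s ^ 2)⁻¹ * ‖ζ.fst‖ ≤ 1 := by
    rw [inv_mul_le_iff₀ hs2, mul_one]
    exact (WithLp.norm_fst_le _ ζ).trans hζs
  have hζ₂ : (s ^ 2)⁻¹ * ‖ζ.snd‖ ≤ 1 := by
    rw [inv_mul_le_iff₀ hs2, mul_one]
    exact (WithLp.norm_snd_le _ ζ).trans hζs
  set T := (2 * (s ^ 2 / 8) - 1) • ContinuousLinearMap.id ℝ V with hT
  have hXY : ∀ a, ⟪((s ^ 2)⁻¹ • (S₁ + T) - -((s ^ 2)⁻¹ • (S₂ + T))) a, a⟫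
      = (s ^ 2)⁻¹ * (⟪(S₁ + S₂) a, a⟫ + (s ^ 2 / 2 - 2) * ‖a‖ ^ 2) := by
    intro a
    simp only [hT, _root_.sub_apply, _root_.neg_apply, _root_.smul_apply, _root_.add_apply,
      ContinuousLinearMap.id_apply, real_inner_smul_left, inner_add_left, inner_sub_left,
      inner_neg_left, real_inner_self_eq_norm_sq]
    ring
  refine ⟨q₁ z.fst, hKB (hq₁ _), q₂ z.snd, hKB (hq₂ _), (s ^ 2)⁻¹ • (q₁ z.fst - z.fst),
    -((s ^ 2)⁻¹ • (q₂ z.snd - z.snd)), (s ^ 2)⁻¹ • (S₁ + T), -((s ^ 2)⁻¹ • (S₂ + T)),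
    ?_, ?_, fun v w => ?_, fun v w => ?_, ?_, ?_, fun a => ?_, e, he, ?_⟩
  · rw [hp₁]
    refine one_le_norm_smul_add hL hb hb2 ((norm_add_le _ _).trans ?_)
    rw [norm_smul, norm_smul, Real.norm_of_nonneg (by positivity : 0 ≤ (s ^ 2)⁻¹)]
    norm_num
    linarith
  · rw [hp₂]
    refine one_le_norm_smul_add hL hb hb2 ((norm_add_le _ _).trans ?_)
    rw [norm_smul, norm_smul, norm_neg, norm_neg,
      Real.norm_of_nonneg (by positivity : 0 ≤ (s ^ 2)⁻¹)]
    norm_num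
    linarith
  · simp only [hT, _root_.smul_apply, _root_.add_apply, ContinuousLinearMap.id_apply,
      real_inner_smul_left, real_inner_smul_right, inner_add_left, inner_add_right, hS₁]
  · simp only [hT, _root_.neg_apply, _root_.smul_apply, _root_.add_apply,
      ContinuousLinearMap.id_apply, inner_neg_left, inner_neg_right,
      real_inner_smul_left, real_inner_smul_right, inner_add_left, inner_add_right, hS₂]
  · exact upper_jet_of_sup_convolution hs.ne' hq₁z (hj₁ z.fst) hE₁
  · filter_upwards [upper_jet_of_sup_convolution (v := fun x => -u x) hs.ne' hq₂z (hj₂ z.snd) hE₂]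
      with a ha
    rw [_root_.neg_apply, inner_neg_left, inner_neg_left]
    linarith
  · rw [hXY, inv_mul_le_iff₀ hs2]
    linarith [hup a]
  · rw [hXY, inv_mul_le_iff₀ hs2, he]
    linarith

end Doubling

section Pucci

open scoped MatrixOrder

variable {n : ℕ}

theorem trace_mul_nonneg_of_posSemidef {A P : Matrix (Fin n) (Fin n) ℝ} (hA : A.PosSemidef)
    (hP : P.PosSemidef) : 0 ≤ (A * P).trace := by
  obtain ⟨B, rfl⟩ := CStarAlgebra.nonneg_iff_eq_star_mul_self.1 hP.nonneg
  rw [Matrix.star_eq_conjTranspose, ← Matrix.mul_assoc, Matrix.trace_mul_comm, ← Matrix.mul_assoc]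
  exact (hA.mul_mul_conjTranspose_same B).trace_nonneg

theorem posSemidef_of_isSymm {A : Matrix (Fin n) (Fin n) ℝ} (hA : A.IsSymm)
    (h : ∀ ξ : Fin n → ℝ, 0 ≤ ξ ⬝ᵥ A *ᵥ ξ) : A.PosSemidef := by
  refine Matrix.PosSemidef.of_dotProduct_mulVec_nonneg ?_ (fun ξ => ?_)
  · rw [Matrix.IsHermitian, Matrix.conjTranspose_eq_transpose_of_trivial]; exact hA
  · simpa using h ξ

theorem pucciSup_le {lam Lam c m : ℝ} (hlam : 0 ≤ lam) (hle : lam ≤ Lam) (hc : 0 ≤ c)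
    {S : Matrix (Fin n) (Fin n) ℝ} (hS : S.IsSymm)
    (hSc : ∀ ξ : Fin n → ℝ, ξ ⬝ᵥ S *ᵥ ξ ≤ c * (ξ ⬝ᵥ ξ)) {e : Fin n → ℝ} (he : e ⬝ᵥ e = 1)
    (heS : e ⬝ᵥ S *ᵥ e ≤ c - m) : pucciSup n lam Lam S ≤ c * (n * Lam) - lam * m := by
  refine csSup_le (Set.Nonempty.image _ ⟨lam • 1, ?_, fun ξ => ?_⟩) ?_
  · exact Matrix.isSymm_one.smul lam
  · have h0 : 0 ≤ ξ ⬝ᵥ ξ := by simpa using dotProduct_star_self_nonneg ξ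
    simp only [Matrix.smul_mulVec, Matrix.one_mulVec, dotProduct_smul, smul_eq_mul]
    exact ⟨le_rfl, by gcongr⟩
  rintro _ ⟨A, ⟨hA, hAb⟩, rfl⟩
  have hP : (c • (1 : Matrix (Fin n) (Fin n) ℝ) - S).PosSemidef := by
    refine posSemidef_of_isSymm ((Matrix.isSymm_one.smul c).sub hS) fun ξ => ?_
    simp only [Matrix.sub_mulVec, dotProduct_sub, Matrix.smul_mulVec, Matrix.one_mulVec,
      dotProduct_smul, smul_eq_mul]
    linarith [hSc ξ]
  have hQ : (A - lam • Matrix.vecMulVec e e).PosSemidef := by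
    refine posSemidef_of_isSymm (hA.sub (Matrix.IsSymm.smul ?_ lam)) fun ξ => ?_
    · exact Matrix.transpose_vecMulVec e e
    · have h1 : (ξ ⬝ᵥ e) ^ 2 ≤ ξ ⬝ᵥ ξ := by
        have := Finset.sum_mul_sq_le_sq_mul_sq Finset.univ ξ e
        simp only [pow_two (ξ _), pow_two (e _)] at this
        change (ξ ⬝ᵥ e) ^ 2 ≤ (ξ ⬝ᵥ ξ) * (e ⬝ᵥ e) at this
        rwa [he, mul_one] at this
      have h2 : ξ ⬝ᵥ (Matrix.vecMulVec e e) *ᵥ ξ = (ξ ⬝ᵥ e) ^ 2 := by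
        rw [Matrix.vecMulVec_mulVec, dotProduct_smul, dotProduct_comm e ξ]
        simp [pow_two]
      simp only [Matrix.sub_mulVec, dotProduct_sub, Matrix.smul_mulVec, dotProduct_smul,
        smul_eq_mul, h2]
      nlinarith [(hAb ξ).1]
  have htr : A.trace ≤ n * Lam := by
    have : ∀ i, A i i ≤ Lam := fun i => by
      have := (hAb (Pi.single i 1)).2
      simpa using this
    calc A.trace ≤ ∑ _i : Fin n, Lam := Finset.sum_le_sum fun i _ => this i
      _ = n * Lam := by simp
  have h1 := trace_mul_nonneg_of_posSemidef hQ hP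
  have h2 : (Matrix.vecMulVec e e * S).trace = e ⬝ᵥ S *ᵥ e := by
    rw [Matrix.trace_mul_comm, Matrix.mul_vecMulVec, Matrix.trace_vecMulVec, dotProduct_comm]
  have h3 : (Matrix.vecMulVec e e).trace = 1 := by rw [Matrix.trace_vecMulVec, he]
  simp only [Matrix.sub_mul, Matrix.mul_sub, Matrix.trace_sub, Matrix.smul_mul, Matrix.mul_smul,
    Matrix.trace_smul, Matrix.mul_one, smul_eq_mul, h2, h3] at h1
  change (A * S).trace ≤ _
  have h4 : c * A.trace ≤ c * (n * Lam) := by gcongr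
  have h5 : lam * (e ⬝ᵥ S *ᵥ e) ≤ lam * (c - m) := by gcongr
  linarith

end Pucci

section TestFunction

open Filter Topology

variable {n : ℕ}

/-- The matrix of a bilinear form in the standard basis. -/
def formMatrix (B : Euc n →L[ℝ] Euc n) : Matrix (Fin n) (Fin n) ℝ :=
  fun i j => ⟪B (EuclideanSpace.single i 1), EuclideanSpace.single j 1⟫

theorem formMatrix_sub (X Y : Euc n →L[ℝ] Euc n) :
    formMatrix (X - Y) = formMatrix X - formMatrix Y := by
  ext i j
  simp only [formMatrix, _root_.sub_apply, inner_sub_left, Matrix.sub_apply]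

theorem isSymm_formMatrix {B : Euc n →L[ℝ] Euc n} (hB : ∀ v w, ⟪B v, w⟫ = ⟪v, B w⟫) :
    (formMatrix B).IsSymm := by
  ext i j
  change ⟪B _, _⟫ = ⟪B _, _⟫
  rw [hB, real_inner_comm]

theorem dotProduct_formMatrix_mulVec (B : Euc n →L[ℝ] Euc n) (v : Euc n) :
    v ⬝ᵥ formMatrix B *ᵥ v = ⟪B v, v⟫ := by
  have hv : v = ∑ i, v i • EuclideanSpace.single i (1 : ℝ) := by
    ext j
    simp [Finset.sum_apply, Pi.single_apply]
  conv_rhs => rw [hv]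
  simp only [map_sum, map_smul, sum_inner, inner_sum, real_inner_smul_left, real_inner_smul_right,
    dotProduct, Matrix.mulVec, Finset.mul_sum, formMatrix]
  rw [Finset.sum_comm]
  refine Finset.sum_congr rfl fun i _ => Finset.sum_congr rfl fun j _ => ?_
  ring

/-- The quadratic polynomial with prescribed value, slope and Hessian at `x`. -/
def quadPoly (c : ℝ) (p x : Euc n) (B : Euc n →L[ℝ] Euc n) (w : Euc n) : ℝ :=
  c + ⟪p, w - x⟫ + ⟪B (w - x), w - x⟫ / 2

theorem contDiff_quadPoly (c : ℝ) (p x : Euc n) (B : Euc n →L[ℝ] Euc n) :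
    ContDiff ℝ 2 (quadPoly c p x B) := by
  unfold quadPoly
  have h : ContDiff ℝ 2 fun w : Euc n => w - x := contDiff_id.sub contDiff_const
  exact (contDiff_const.add (contDiff_const.inner ℝ h)).add
    (((B.contDiff.comp h).inner ℝ h).div_const 2)

variable {B : Euc n →L[ℝ] Euc n}

theorem hasFDerivAt_quadPoly (hB : ∀ v w, ⟪B v, w⟫ = ⟪v, B w⟫) (c : ℝ) (p x w : Euc n) :
    HasFDerivAt (quadPoly c p x B) (innerSL ℝ (p + B (w - x))) w := by
  have h : HasFDerivAt (fun w : Euc n => w - x) (ContinuousLinearMap.id ℝ (Euc n)) w :=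
    (hasFDerivAt_id w).sub_const x
  have h1 := (((hasFDerivAt_const p w).inner ℝ h).const_add c).add
    (((B.hasFDerivAt.comp w h).inner ℝ h).mul_const (1 / 2))
  have h2 : quadPoly c p x B = (fun w => c + ⟪p, w - x⟫) +
      fun w => ⟪(B ∘ fun w => w - x) w, w - x⟫ * (1 / 2) := by
    funext w
    simp only [quadPoly, Pi.add_apply, Function.comp]
    ring
  rw [h2]
  refine h1.congr_fderiv ?_
  ext v
  have h3 : ⟪w - x, B v⟫ = ⟪B (w - x), v⟫ := (hB _ _).symm
  simp only [_root_.add_apply, _root_.smul_apply, ContinuousLinearMap.comp_apply,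
    ContinuousLinearMap.prod_apply, _root_.zero_apply, ContinuousLinearMap.id_apply,
    fderivInnerCLM_apply, Function.comp, inner_zero_left, add_zero, innerSL_apply_apply,
    inner_add_left, real_inner_comm (w - x) (B v), h3, smul_eq_mul]
  ring

theorem gradient_quadPoly (hB : ∀ v w, ⟪B v, w⟫ = ⟪v, B w⟫) (c : ℝ) (p x : Euc n) :
    gradient (quadPoly c p x B) x = p := by
  refine HasGradientAt.gradient ?_
  rw [hasGradientAt_iff_hasFDerivAt]
  refine (hasFDerivAt_quadPoly hB c p x x).congr_fderiv ?_
  ext v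
  simp

theorem hess_quadPoly (hB : ∀ v w, ⟪B v, w⟫ = ⟪v, B w⟫) (c : ℝ) (p x : Euc n) :
    hess (quadPoly c p x B) x = formMatrix B := by
  have h1 : fderiv ℝ (quadPoly c p x B) = fun w => innerSL ℝ (p + B (w - x)) :=
    funext fun w => (hasFDerivAt_quadPoly hB c p x w).fderiv
  have h2 : HasFDerivAt (fun w => innerSL ℝ (p + B (w - x))) ((innerSL ℝ).comp B) x := by
    have h : HasFDerivAt (fun w : Euc n => w - x) (ContinuousLinearMap.id ℝ (Euc n)) x :=
      (hasFDerivAt_id x).sub_const x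
    exact (innerSL ℝ).hasFDerivAt.comp x ((B.hasFDerivAt.comp x h).const_add p)
  ext i j
  rw [hess, iteratedFDeriv_two_apply, h1, h2.fderiv]
  simp [formMatrix]

end TestFunction

section Viscosity

open Filter Topology

variable {n : ℕ}

theorem isLocalMax_sub_quadPoly {u : Euc n → ℝ} {x p : Euc n} {B : Euc n →L[ℝ] Euc n}
    (h : ∀ᶠ a in 𝓝 (0 : Euc n), u (x + a) ≤ u x + ⟪p, a⟫ + ⟪B a, a⟫ / 2) :
    IsLocalMax (fun w => u w - quadPoly (u x) p x B w) x := by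
  have h1 : Tendsto (fun w => w - x) (𝓝 x) (𝓝 0) :=
    (continuous_id.sub continuous_const).tendsto' x 0 (sub_self x)
  filter_upwards [h1.eventually h] with w hw
  rw [add_sub_cancel] at hw
  simp only [quadPoly, sub_self, inner_zero_right, add_zero, map_zero, zero_div]
  linarith

theorem isLocalMin_sub_quadPoly {u : Euc n → ℝ} {x p : Euc n} {B : Euc n →L[ℝ] Euc n}
    (h : ∀ᶠ a in 𝓝 (0 : Euc n), u x + ⟪p, a⟫ + ⟪B a, a⟫ / 2 ≤ u (x + a)) :
    IsLocalMin (fun w => u w - quadPoly (u x) p x B w) x := by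
  have h1 : Tendsto (fun w => w - x) (𝓝 x) (𝓝 0) :=
    (continuous_id.sub continuous_const).tendsto' x 0 (sub_self x)
  filter_upwards [h1.eventually h] with w hw
  rw [add_sub_cancel] at hw
  simp only [quadPoly, sub_self, inner_zero_right, add_zero, map_zero, zero_div]
  linarith

theorem neg_le_of_neg_le_mul {k t M : ℝ} (hk : 1 ≤ k) (hM : 0 ≤ M) (h : -M ≤ k * t) : -M ≤ t := by
  by_contra! ht
  nlinarith

end Viscosity

/-- Corollary 6.1: uniform-in-`q` Lipschitz estimate for normalized
viscosity solutions of `|Du|^q F(D²u) = f`. -/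
theorem uniform_in_q_lipschitz
    (n : ℕ) (hn : 1 ≤ n) (lam Lam Mf : ℝ) (hlam : 0 < lam) (hlamLam : lam ≤ Lam) :
    ∃ C > 0, ∀ q : ℝ, 0 ≤ q →
      ∀ F : Matrix (Fin n) (Fin n) ℝ → ℝ, IsUniformlyElliptic n lam Lam F →
      ∀ f u : Euc n → ℝ,
        ContinuousOn f (ball 0 1) → (∀ x ∈ ball (0 : Euc n) 1, |f x| ≤ Mf) →
        ContinuousOn u (ball 0 1) → (∀ x ∈ ball (0 : Euc n) 1, |u x| ≤ 1) →
        ViscSol (fun ξ M => ‖ξ‖ ^ q * F M) f (ball 0 1) u →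
        ∀ x ∈ ball (0 : Euc n) (1/2), ∀ y ∈ ball (0 : Euc n) (1/2),
          |u x - u y| ≤ C * ‖x - y‖ := by
  have hn0 : (0 : ℝ) ≤ n := n.cast_nonneg
  have hLam : 0 ≤ Lam := hlam.le.trans hlamLam
  obtain ⟨R, hR⟩ : ∃ R, R = (129 * (n * Lam) + 2 * |Mf|) / lam := ⟨_, rfl⟩
  have hR0 : 0 ≤ R := by rw [hR]; positivity
  have hRl : lam * R = 129 * (n * Lam) + 2 * |Mf| := by rw [hR]; field_simp
  refine ⟨72 + R, by linarith, fun q hq F hF f u _ hfM hu hu1 hvisc => ?_⟩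
  suffices key : ∀ x ∈ ball (0 : Euc n) (1 / 2), ∀ y ∈ ball (0 : Euc n) (1 / 2),
      u x - u y ≤ (72 + R) * ‖x - y‖ by
    intro x hx y hy
    refine abs_sub_le_iff.2 ⟨key x hx y hy, ?_⟩
    rw [norm_sub_rev]
    exact key y hy x hx
  intro x₀ hx₀ y₀ hy₀
  by_contra! hlt
  obtain ⟨x, hx, y, hy, p₁, p₂, X, Y, hp₁, hp₂, hX, hY, hjx, hjy, hup, e, he, hdown⟩ :=
    exists_doubling_jets hu hu1 (by linarith) hx₀ hy₀ hlt
  have hM : 0 ≤ Mf := (abs_nonneg _).trans (hfM x hx)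
  have h1 := hvisc.1 x hx _ (contDiff_quadPoly _ _ _ _) (isLocalMax_sub_quadPoly hjx)
  have h2 := hvisc.2 y hy _ (contDiff_quadPoly _ _ _ _) (isLocalMin_sub_quadPoly hjy)
  simp only [gradient_quadPoly hX, hess_quadPoly hX] at h1
  simp only [gradient_quadPoly hY, hess_quadPoly hY] at h2
  have h3 : -Mf ≤ F (formMatrix X) := neg_le_of_neg_le_mul (Real.one_le_rpow hp₁ hq) hM
    (by linarith [(abs_le.1 (hfM x hx)).1])
  have h4 : -Mf ≤ -F (formMatrix Y) := neg_le_of_neg_le_mul (Real.one_le_rpow hp₂ hq) hM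
    (by rw [mul_neg]; linarith [(abs_le.1 (hfM y hy)).2])
  have h5 := (hF _ _ (isSymm_formMatrix hX) (isSymm_formMatrix hY)).2
  have hXY : ∀ v w, ⟪(X - Y) v, w⟫ = ⟪v, (X - Y) w⟫ := fun v w => by
    rw [_root_.sub_apply, _root_.sub_apply, inner_sub_left, inner_sub_right, hX, hY]
  have hsq : ∀ v : Euc n, v.ofLp ⬝ᵥ v.ofLp = ‖v‖ ^ 2 := fun v => by
    rw [EuclideanSpace.real_norm_sq_eq]
    exact Finset.sum_congr rfl fun i _ => (pow_two _).symm
  have h6 := pucciSup_le (c := 129) (m := 2 * (72 + R)) hlam.le hlamLam (by norm_num)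
    (isSymm_formMatrix hXY)
    (fun ξ => by
      have := hup (WithLp.toLp 2 ξ)
      rwa [← dotProduct_formMatrix_mulVec, ← hsq] at this)
    (e := e.ofLp) (by rw [hsq, he, one_pow])
    (by rw [dotProduct_formMatrix_mulVec]; exact hdown)
  rw [formMatrix_sub] at h6
  nlinarith [abs_nonneg Mf, le_abs_self Mf]

end
end

section
/- Let F be (λ,Λ)-elliptic and continuous, let f ∈ L^∞(B₁) be continuous, let q_k → ∞ be a sequence of nonnegative reals, and for each k let u_k be a classical viscosity solution of |Du_k|^{q_k} F(D²u_k) = f in B₁ with ‖u_k‖_{L^∞(B₁)} ≤ 1. If u_k → u_∞ locally uniformly in B₁, then u_∞ is a 1-grad viscosity solution of F(D²u_∞) = 0 in B₁; that is, for every x₀ ∈ B₁ and every C² function φ with |Dφ(x₀)| > 1: if u_∞ − φ has a local maximum at x₀ then F(D²φ(x₀)) ≥ 0, and if u_∞ − φ has a local minimum at x₀ then F(D²φ(x₀)) ≤ 0. -/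
open Metric Set Matrix MeasureTheory
open scoped RealInnerProductSpace

noncomputable section

open Filter Topology

theorem hess_add_smul {n : ℕ} {φ ψ : Euc n → ℝ} (hφ : ContDiff ℝ 2 φ) (hψ : ContDiff ℝ 2 ψ)
    (δ : ℝ) (x : Euc n) : hess (fun y => φ y + δ * ψ y) x = hess φ x + δ • hess ψ x := by
  have h1 : (fun y => φ y + δ * ψ y) = φ + δ • ψ := rfl
  have h2 : ContDiffAt ℝ 2 (δ • ψ) x := (hψ.const_smul δ).contDiffAt
  ext i j
  simp only [hess, h1]
  rw [iteratedFDeriv_add_apply hφ.contDiffAt h2,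
    iteratedFDeriv_const_smul_apply hψ.contDiffAt]
  simp [hess]

theorem hess_neg {n : ℕ} (φ : Euc n → ℝ) (x : Euc n) :
    hess (fun y => -φ y) x = -hess φ x := by
  have h1 : (fun y => -φ y) = -φ := rfl
  ext i j
  simp only [hess, h1]
  rw [iteratedFDeriv_neg_apply]
  simp [hess]

theorem gradient_add_mul {n : ℕ} {φ ψ : Euc n → ℝ} (hφ : Differentiable ℝ φ)
    (hψ : Differentiable ℝ ψ) (δ : ℝ) (x : Euc n) :
    gradient (fun y => φ y + δ * ψ y) x = gradient φ x + δ • gradient ψ x := by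
  have h : HasFDerivAt (fun y => φ y + δ * ψ y) (fderiv ℝ φ x + δ • fderiv ℝ ψ x) x :=
    (hφ x).hasFDerivAt.add ((hψ x).hasFDerivAt.const_mul δ)
  simp [gradient, h.fderiv]

theorem gradient_fun_neg {n : ℕ} (φ : Euc n → ℝ) (x : Euc n) :
    gradient (fun y => -φ y) x = -gradient φ x := by
  simp [gradient, fderiv_fun_neg]

theorem continuous_hess {n : ℕ} {φ : Euc n → ℝ} (hφ : ContDiff ℝ 2 φ) :
    Continuous (hess φ) := by
  have h := hφ.continuous_iteratedFDeriv (m := 2) le_rfl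
  refine continuous_pi fun i => continuous_pi fun j => ?_
  exact (ContinuousMultilinearMap.apply ℝ (fun _ : Fin 2 => Euc n) ℝ
    ![EuclideanSpace.single i 1, EuclideanSpace.single j 1]).continuous.comp h

theorem continuous_gradient {n : ℕ} {φ : Euc n → ℝ} (hφ : ContDiff ℝ 2 φ) :
    Continuous (gradient φ) :=
  (InnerProductSpace.toDual ℝ (Euc n)).symm.continuous.comp
    (hφ.continuous_fderiv (by norm_num))

/-- Maximizers of locally uniformly convergent functions converge to a strict maximizer of
the limit. -/
theorem exists_maximizers_tendsto {X : Type*} [MetricSpace X] {K : Set X} (hK : IsCompact K)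
    {x₀ : X} (hx₀ : x₀ ∈ K) {v : ℕ → X → ℝ} {w : X → ℝ} (hv : ∀ k, ContinuousOn (v k) K)
    (hw : ContinuousOn w K) (hlim : TendstoUniformlyOn v w atTop K)
    (hstrict : ∀ x ∈ K, x ≠ x₀ → w x < w x₀) :
    ∃ y : ℕ → X, (∀ k, IsMaxOn (v k) K (y k)) ∧ Tendsto y atTop (𝓝 x₀) := by
  have hex := fun k => hK.exists_isMaxOn ⟨x₀, hx₀⟩ (hv k)
  choose y hyK hy using hex
  refine ⟨y, hy, ?_⟩
  rw [Metric.tendsto_nhds]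
  intro ε hε
  have hC : IsCompact (K \ ball x₀ ε) := hK.diff isOpen_ball
  rcases (K \ ball x₀ ε).eq_empty_or_nonempty with he | hne
  · refine Eventually.of_forall fun k => ?_
    by_contra hcon
    have : y k ∈ K \ ball x₀ ε := ⟨hyK k, hcon⟩
    simp [he] at this
  · obtain ⟨z, hz, hzmax⟩ := hC.exists_isMaxOn hne (hw.mono sdiff_subset)
    have hzx : z ≠ x₀ := by
      rintro rfl
      exact hz.2 (mem_ball_self hε)
    have hgap := hstrict z hz.1 hzx
    rw [Metric.tendstoUniformlyOn_iff] at hlim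
    filter_upwards [hlim ((w x₀ - w z) / 2) (by linarith)] with k hk
    by_contra hcon
    have h1 := hk x₀ hx₀
    have h2 := hk (y k) (hyK k)
    have h3 : w (y k) ≤ w z := hzmax (⟨hyK k, hcon⟩ : y k ∈ K \ ball x₀ ε)
    have h4 : v k x₀ ≤ v k (y k) := hy k hx₀
    rw [Real.dist_eq, abs_lt] at h1 h2
    linarith

/-- The subsolution half of the limit, for a test function touching strictly. -/
theorem nonneg_of_strict_touching {n : ℕ} {F : Matrix (Fin n) (Fin n) ℝ → ℝ}
    (hFc : Continuous F) {s : Set (Euc n)} {f : Euc n → ℝ} {Mf : ℝ}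
    (hfb : ∀ x ∈ s, |f x| ≤ Mf)
    {qk : ℕ → ℝ} (hqk : ∀ k, 0 ≤ qk k) (hqkTop : Tendsto qk atTop atTop)
    {uk : ℕ → Euc n → ℝ} (huc : ∀ k, ContinuousOn (uk k) s)
    (hsub : ∀ k, ∀ x₀ ∈ s, ∀ φ : Euc n → ℝ, ContDiff ℝ 2 φ →
      IsLocalMax (fun x => uk k x - φ x) x₀ →
      f x₀ ≤ ‖gradient φ x₀‖ ^ qk k * F (hess φ x₀))
    {uInf : Euc n → ℝ} (huInf : ContinuousOn uInf s)
    {x₀ : Euc n} {r : ℝ} (hr : 0 < r) (hrs : closedBall x₀ r ⊆ s)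
    (hlim : TendstoUniformlyOn uk uInf atTop (closedBall x₀ r))
    {φ : Euc n → ℝ} (hφ : ContDiff ℝ 2 φ)
    (hstrict : ∀ x ∈ closedBall x₀ r, x ≠ x₀ → uInf x - φ x < uInf x₀ - φ x₀)
    (hgrad : 1 < ‖gradient φ x₀‖) : 0 ≤ F (hess φ x₀) := by
  obtain ⟨y, hymax, hylim⟩ := exists_maximizers_tendsto (isCompact_closedBall x₀ r)
    (mem_closedBall_self hr.le) (v := fun k x => uk k x - φ x) (w := fun x => uInf x - φ x)
    (fun k => ((huc k).mono hrs).sub hφ.continuous.continuousOn)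
    ((huInf.mono hrs).sub hφ.continuous.continuousOn)
    (by
      rw [Metric.tendstoUniformlyOn_iff] at hlim ⊢
      simpa using hlim) hstrict
  obtain ⟨b, hb1, hb⟩ := exists_between hgrad
  have hFlim : Tendsto (fun k => F (hess φ (y k))) atTop (𝓝 (F (hess φ x₀))) :=
    ((hFc.comp (continuous_hess hφ)).tendsto x₀).comp hylim
  have hgradlim : Tendsto (fun k => ‖gradient φ (y k)‖) atTop (𝓝 ‖gradient φ x₀‖) :=
    ((continuous_gradient hφ).norm.tendsto x₀).comp hylim
  have hpow : Tendsto (fun k => b ^ qk k) atTop atTop :=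
    (tendsto_rpow_atTop_of_base_gt_one b hb1).comp hqkTop
  have hzero : Tendsto (fun k => -Mf / b ^ qk k) atTop (𝓝 0) := hpow.const_div_atTop _
  refine le_of_tendsto_of_tendsto hzero hFlim ?_
  filter_upwards [hgradlim.eventually_const_lt hb, hylim.eventually (ball_mem_nhds x₀ hr)]
    with k hk hyk
  have hys : y k ∈ s := hrs (ball_subset_closedBall hyk)
  have hloc : IsLocalMax (fun x => uk k x - φ x) (y k) :=
    (hymax k).isLocalMax
      (mem_of_superset (isOpen_ball.mem_nhds hyk) ball_subset_closedBall)
  have h1 := hsub k (y k) hys φ hφ hloc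
  have h2 := neg_le_of_abs_le (hfb _ hys)
  have hM : 0 ≤ Mf := (abs_nonneg _).trans (hfb _ hys)
  have hbpos : 0 < b ^ qk k := Real.rpow_pos_of_pos (by linarith) _
  have hle : b ^ qk k ≤ ‖gradient φ (y k)‖ ^ qk k :=
    Real.rpow_le_rpow (by linarith) hk.le (hqk k)
  rw [div_le_iff₀ hbpos]
  rcases le_total 0 (F (hess φ (y k))) with h | h
  · nlinarith
  · nlinarith

/-- The subsolution half of the limit. -/
theorem gradSubSol_limit {n : ℕ} {F : Matrix (Fin n) (Fin n) ℝ → ℝ}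
    (hFc : Continuous F) {s : Set (Euc n)} (hs : IsOpen s) {f : Euc n → ℝ} {Mf : ℝ}
    (hfb : ∀ x ∈ s, |f x| ≤ Mf)
    {qk : ℕ → ℝ} (hqk : ∀ k, 0 ≤ qk k) (hqkTop : Tendsto qk atTop atTop)
    {uk : ℕ → Euc n → ℝ} (huc : ∀ k, ContinuousOn (uk k) s)
    (hsub : ∀ k, ∀ x₀ ∈ s, ∀ φ : Euc n → ℝ, ContDiff ℝ 2 φ →
      IsLocalMax (fun x => uk k x - φ x) x₀ →
      f x₀ ≤ ‖gradient φ x₀‖ ^ qk k * F (hess φ x₀))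
    {uInf : Euc n → ℝ} (huInf : ContinuousOn uInf s)
    (hlim : TendstoLocallyUniformlyOn uk uInf atTop s) :
    GradSubSol 1 (fun _ M => F M) (fun _ => 0) s uInf := by
  intro x₀ hx₀ φ hφ hmax hgrad
  obtain ⟨r, hr, hball⟩ := Metric.nhds_basis_closedBall.mem_iff.1
    (inter_mem (hs.mem_nhds hx₀) hmax)
  have hrs : closedBall x₀ r ⊆ s := hball.trans inter_subset_left
  have hlim' : TendstoUniformlyOn uk uInf atTop (closedBall x₀ r) :=
    (tendstoLocallyUniformlyOn_iff_forall_isCompact hs).1 hlim _ hrs (isCompact_closedBall x₀ r)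
  let ψ : Euc n → ℝ := fun x => ‖x - x₀‖ ^ 2
  have hψ : ContDiff ℝ 2 ψ := (contDiff_id.sub contDiff_const).norm_sq ℝ
  have hgradlim : Tendsto (fun δ : ℝ => ‖gradient φ x₀ + δ • gradient ψ x₀‖) (𝓝[>] 0)
      (𝓝 ‖gradient φ x₀‖) := by
    have h : Continuous fun δ : ℝ => ‖gradient φ x₀ + δ • gradient ψ x₀‖ := by fun_prop
    simpa using (h.tendsto 0).mono_left nhdsWithin_le_nhds
  have hFlim : Tendsto (fun δ : ℝ => F (hess φ x₀ + δ • hess ψ x₀)) (𝓝[>] 0)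
      (𝓝 (F (hess φ x₀))) := by
    have h : Continuous fun δ : ℝ => F (hess φ x₀ + δ • hess ψ x₀) := by fun_prop
    simpa using (h.tendsto 0).mono_left nhdsWithin_le_nhds
  refine ge_of_tendsto hFlim ?_
  filter_upwards [hgradlim.eventually_const_lt hgrad, self_mem_nhdsWithin] with δ hδ hpos
  rw [← hess_add_smul hφ hψ]
  refine nonneg_of_strict_touching hFc hfb hqk hqkTop huc hsub huInf hr hrs hlim'
    (hφ.add (contDiff_const.mul hψ)) ?_ ?_
  · intro x hx hne
    have h1 : uInf x - φ x ≤ uInf x₀ - φ x₀ := (hball hx).2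
    have h2 : 0 < δ * ‖x - x₀‖ ^ 2 :=
      mul_pos hpos (pow_pos (norm_pos_iff.2 (sub_ne_zero.2 hne)) 2)
    simp only [ψ, sub_self, norm_zero]
    linarith
  · rwa [gradient_add_mul (hφ.differentiable (by norm_num)) (hψ.differentiable (by norm_num))]

/-- Subsection 6.2: the local uniform limit of normalized solutions
of `|Du_k|^{q_k} F(D²u_k) = f` with `q_k → ∞` is a `1`-grad viscosity solution of
`F(D²u_∞) = 0`. -/
theorem limit_infinite_degeneracy
    (n : ℕ) (hn : 1 ≤ n) (lam Lam : ℝ) (hlam : 0 < lam) (hlamLam : lam ≤ Lam)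
    (F : Matrix (Fin n) (Fin n) ℝ → ℝ) (hF : IsUniformlyElliptic n lam Lam F)
    (hFc : Continuous F)
    (f : Euc n → ℝ) (hf : ContinuousOn f (ball 0 1))
    (Mf : ℝ) (hfb : ∀ x ∈ ball (0 : Euc n) 1, |f x| ≤ Mf)
    (qk : ℕ → ℝ) (hqk : ∀ k, 0 ≤ qk k) (hqkTop : Tendsto qk atTop atTop)
    (uk : ℕ → Euc n → ℝ) (huc : ∀ k, ContinuousOn (uk k) (ball 0 1))
    (hub : ∀ k, ∀ x ∈ ball (0 : Euc n) 1, |uk k x| ≤ 1)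
    (hsol : ∀ k, ViscSol (fun ξ M => ‖ξ‖ ^ (qk k) * F M) f (ball 0 1) (uk k))
    (uInf : Euc n → ℝ) (huInf : ContinuousOn uInf (ball 0 1))
    (hlim : TendstoLocallyUniformlyOn uk uInf atTop (ball 0 1)) :
    GradSol 1 (fun _ M => F M) (fun _ => 0) (ball 0 1) uInf := by
  refine ⟨gradSubSol_limit hFc isOpen_ball hfb hqk hqkTop huc (fun k => (hsol k).1) huInf hlim,
    ?_⟩
  have hneg : GradSubSol 1 (fun _ M => -F (-M)) (fun _ => 0) (ball 0 1) fun x => -uInf x := by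
    refine gradSubSol_limit (F := fun M => -F (-M)) (f := fun x => -f x) (Mf := Mf)
      (uk := fun k x => -uk k x) (by fun_prop) isOpen_ball
      (fun x hx => by simpa using hfb x hx) hqk hqkTop (fun k => (huc k).neg) ?_ huInf.neg ?_
    · intro k x hx φ hφ hmax
      have hmin : IsLocalMin (fun y => uk k y - -φ y) x := by
        filter_upwards [hmax] with y hy
        linarith
      have h := (hsol k).2 x hx (fun y => -φ y) hφ.neg hmin
      simp only [gradient_fun_neg, hess_neg, norm_neg] at h
      linarith
    · rw [Metric.tendstoLocallyUniformlyOn_iff] at hlim ⊢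
      simpa using hlim
  intro x hx φ hφ hmin hgrad
  have hmax : IsLocalMax (fun y => -uInf y - -φ y) x := by
    filter_upwards [hmin] with y hy
    linarith
  have h := hneg x hx (fun y => -φ y) hφ.neg hmax
    (by rwa [gradient_fun_neg, norm_neg])
  simp only [hess_neg, neg_neg] at h
  linarith

end
end
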